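/- arXiv:math/0102200 — 2 statements merged into one kernel-verified Lean document; each statement's English description precedes it below -/
import Mathlib

section
/- Let G=(V,w) be a weighted graph, o a vertex and z a set of vertices with dist(o,z) ≥ n+1 for an integer n ≥ 1, and set g := (w_z r_{oz})^{1/n}, where r_{oz} is the effective resistance between o and z; assume g > 1. Then for every λ ≥ 0, E[e^{−λ(T'_{0n}+1)}] ≥ E[e^{−λ T_{oz}}], where T'_{0n} is the hitting time of n from 0 for biased simple random walk on ℤ with odds 1:g of going left/right. -/
open MeasureTheory Filter
open scoped Classical ENNReal

namespace RWHitting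

/-- A weighted graph on a vertex set `V`: a symmetric weight function with
positive finite vertex weights. -/
structure WeightedGraph (V : Type*) where
  w : V → V → ℝ≥0∞
  symm : ∀ x y, w x y = w y x
  vw_pos : ∀ x, 0 < ∑' y, w x y
  vw_lt_top : ∀ x, ∑' y, w x y < ⊤

namespace WeightedGraph

variable {V : Type*}

/-- The weight of a vertex. -/
noncomputable def vw (G : WeightedGraph V) (x : V) : ℝ≥0∞ := ∑' y, G.w x y

/-- The weight of a vertex set. -/
noncomputable def setWeight (G : WeightedGraph V) (z : Set V) : ℝ≥0∞ := ∑' x : z, G.vw x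

/-- `G.distGE o z m` : every path of positive-weight steps from `o` into `z` has length `≥ m`. -/
def distGE (G : WeightedGraph V) (o : V) (z : Set V) (m : ℕ) : Prop :=
  ∀ (k : ℕ) (p : ℕ → V), p 0 = o → (∀ i, i < k → 0 < G.w (p i) (p (i+1))) → p k ∈ z → m ≤ k

/-- Transition probabilities of the random walk on `G`. -/
noncomputable def trans (G : WeightedGraph V) (x y : V) : ℝ≥0∞ := G.w x y / G.vw x

/-- Graph distance (as an extended nonneg real). -/
noncomputable def edist (G : WeightedGraph V) (x y : V) : ℝ≥0∞ :=
  ⨅ (k : ℕ) (_ : ∃ p : ℕ → V, p 0 = x ∧ p k = y ∧ ∀ i, i < k → 0 < G.w (p i) (p (i+1))),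
    (k : ℝ≥0∞)

/-- Total weight of the edges at distance `n` from `o` (each non-loop edge counted in both
orientations). -/
noncomputable def boundaryWeight (G : WeightedGraph V) (o : V) (n : ℕ) : ℝ≥0∞ :=
  ∑' q : V × V, if min (G.edist o q.1) (G.edist o q.2) = (n : ℝ≥0∞) then G.w q.1 q.2 else 0

end WeightedGraph

variable {V : Type*}

/-- `μ` is the law of the random walk on `G` started at `o`. -/
def IsRandomWalk [MeasurableSpace V] (G : WeightedGraph V) (o : V)
    (μ : Measure (ℕ → V)) : Prop :=
  IsProbabilityMeasure μ ∧
  ∀ (k : ℕ) (x : Fin (k+1) → V),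
    μ {ω | ∀ i : Fin (k+1), ω (i : ℕ) = x i}
      = (if x 0 = o then 1 else 0) * ∏ i : Fin k, G.trans (x i.castSucc) (x i.succ)

/-- First hitting time of the set `z` (`∞` if `z` is never visited). -/
noncomputable def hitTime (z : Set V) (ω : ℕ → V) : ℝ≥0∞ :=
  ⨅ (k : ℕ) (_ : ω k ∈ z), (k : ℝ≥0∞)

/-- Expected hitting time of `z`. -/
noncomputable def expHit [MeasurableSpace V] (μ : Measure (ℕ → V)) (z : Set V) : ℝ≥0∞ :=
  ∫⁻ ω, hitTime z ω ∂μ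

/-- Number of visits to `o` (counting time 0) strictly before hitting `z`. -/
noncomputable def visitsBefore (z : Set V) (o : V) (ω : ℕ → V) : ℝ≥0∞ :=
  ∑' k : ℕ, if ω k = o ∧ (k : ℝ≥0∞) < hitTime z ω then 1 else 0

/-- Effective resistance between `o` and `z`, defined probabilistically via the random walk
law `μ`:  `w_o r_{oz}` is the expected number of visits to `o` before hitting `z`. -/
noncomputable def resistance [MeasurableSpace V] (G : WeightedGraph V) (o : V) (z : Set V)
    (μ : Measure (ℕ → V)) : ℝ≥0∞ :=
  (∫⁻ ω, visitsBefore z o ω ∂μ) / G.vw o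

/-- One-step transition probabilities for the biased simple random walk on `ℤ`
with odds `1 : g` of going left/right. -/
noncomputable def biasedStep (g : ℝ) (a b : ℤ) : ℝ≥0∞ :=
  if b = a + 1 then ENNReal.ofReal (g / (g+1))
  else if b = a - 1 then ENNReal.ofReal (1 / (g+1)) else 0

/-- `ν` is the law of the biased simple random walk on `ℤ` started at `0`,
stepping right with probability `g/(g+1)` and left with probability `1/(g+1)`. -/
def IsBiasedWalk (g : ℝ) (ν : Measure (ℕ → ℤ)) : Prop :=
  IsProbabilityMeasure ν ∧
  ∀ (k : ℕ) (x : Fin (k+1) → ℤ),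
    ν {ω | ∀ i : Fin (k+1), ω (i : ℕ) = x i}
      = (if x 0 = 0 then 1 else 0) * ∏ i : Fin k, biasedStep g (x i.castSucc) (x i.succ)

/-- `e^{-λ t}` for an extended-real time `t`, with the convention `e^{-λ ∞} = 0`. -/
noncomputable def expNeg (lam : ℝ) (t : ℝ≥0∞) : ℝ≥0∞ :=
  if t = ⊤ then 0 else ENNReal.ofReal (Real.exp (-lam * t.toReal))


section MarkovLaw

/-- `μ` is the law of the Markov chain with transition probabilities `P` started at `o`. -/
def IsMarkovLaw [MeasurableSpace V] (P : V → V → ℝ≥0∞) (o : V) (μ : Measure (ℕ → V)) : Prop :=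
  IsProbabilityMeasure μ ∧
  ∀ (k : ℕ) (x : Fin (k+1) → V),
    μ {ω | ∀ i : Fin (k+1), ω (i : ℕ) = x i}
      = (if x 0 = o then 1 else 0) * ∏ i : Fin k, P (x i.castSucc) (x i.succ)

/-- The mass of the paths that are at `x` at time `k` and avoid `z` up to that time. -/
noncomputable def taboo [MeasurableSpace V] (μ : Measure (ℕ → V)) (z : Set V) (k : ℕ) (x : V) :
    ℝ≥0∞ :=
  μ {ω | ω k = x ∧ ∀ j ≤ k, ω j ∉ z}

lemma measure_eq_tsum_inter_fiber {Ω β : Type*} [MeasurableSpace Ω] [MeasurableSpace β]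
    [Countable β] [MeasurableSingletonClass β] (μ : Measure Ω) {f : Ω → β} (hf : Measurable f)
    (A : Set Ω) : μ A = ∑' b, μ (A ∩ f ⁻¹' {b}) := by
  have h := tsum_measure_preimage_singleton (μ := μ.restrict A) (Set.countable_univ (α := β))
    (f := f) (fun b _ => hf (measurableSet_singleton b))
  rw [Set.preimage_univ, Measure.restrict_apply_univ, tsum_univ
    (fun b => (μ.restrict A) (f ⁻¹' {b}))] at h
  rw [← h]
  refine tsum_congr fun b => ?_
  rw [Measure.restrict_apply (hf (measurableSet_singleton b)), Set.inter_comm]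

variable [MeasurableSpace V] {P : V → V → ℝ≥0∞} {o : V} {μ : Measure (ℕ → V)}

lemma taboo_of_mem {z : Set V} {x : V} (hx : x ∈ z) (k : ℕ) : taboo μ z k x = 0 := by
  have : {ω : ℕ → V | ω k = x ∧ ∀ j ≤ k, ω j ∉ z} = ∅ := by
    ext ω
    simp only [Set.mem_ofPred_eq, Set.mem_empty_iff_false, iff_false, not_and]
    intro h h'
    exact h' k le_rfl (h ▸ hx)
  rw [taboo, this, measure_empty]

lemma IsMarkovLaw.measure_init (hμ : IsMarkovLaw P o μ) (x : V) :
    μ {ω | ω 0 = x} = if x = o then 1 else 0 := by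
  have h := hμ.2 0 (fun _ => x)
  simpa using h

lemma IsMarkovLaw.taboo_zero (hμ : IsMarkovLaw P o μ) {z : Set V} (ho : o ∉ z) (x : V) :
    taboo μ z 0 x = if x = o then 1 else 0 := by
  by_cases hx : x ∈ z
  · rw [taboo_of_mem hx, if_neg]
    rintro rfl
    exact ho hx
  · rw [← hμ.measure_init, taboo]
    congr 1
    ext ω
    simp only [nonpos_iff_eq_zero, forall_eq, Set.mem_ofPred_eq, and_iff_left_iff_imp]
    rintro rfl
    exact hx

lemma IsMarkovLaw.measure_snoc (hμ : IsMarkovLaw P o μ) (k : ℕ) (x : Fin (k+1) → V) (y : V) :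
    μ {ω | (∀ i : Fin (k+1), ω (i : ℕ) = x i) ∧ ω (k+1) = y}
      = μ {ω | ∀ i : Fin (k+1), ω (i : ℕ) = x i} * P (x (Fin.last k)) y := by
  have h := hμ.2 (k+1) (Fin.snoc x y)
  rw [Fin.prod_univ_castSucc] at h
  have h0 : (Fin.snoc x y : Fin (k+2) → V) 0 = x 0 := by
    rw [← Fin.castSucc_zero, Fin.snoc_castSucc]
  have hset : {ω : ℕ → V | ∀ i : Fin (k+2), ω (i : ℕ) = (Fin.snoc x y : Fin (k+2) → V) i}
      = {ω | (∀ i : Fin (k+1), ω (i : ℕ) = x i) ∧ ω (k+1) = y} := by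
    ext ω
    simp [Fin.forall_fin_succ']
  simp only [Fin.succ_castSucc, Fin.snoc_castSucc, Fin.succ_last, Fin.snoc_last] at h
  rw [hset, h0, ← mul_assoc, ← hμ.2] at h
  exact h

variable [Countable V] [MeasurableSingletonClass V]

/-- The Markov property for paths that avoid `z`. -/
lemma IsMarkovLaw.measure_step (hμ : IsMarkovLaw P o μ) (z : Set V) (k : ℕ) (y : V) :
    μ {ω | ω (k+1) = y ∧ ∀ j ≤ k, ω j ∉ z} = ∑' x, taboo μ z k x * P x y := by
  have hmeas : Measurable (fun (ω : ℕ → V) (i : Fin (k+1)) => ω (i : ℕ)) := by fun_prop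
  have hforall (ω : ℕ → V) (x : Fin (k+1) → V) (hx : (fun i : Fin (k+1) => ω (i : ℕ)) = x) :
      (∀ j ≤ k, ω j ∉ z) ↔ ∀ i, x i ∉ z := by
    subst hx
    exact ⟨fun h i => h i (Nat.lt_succ_iff.1 i.2), fun h j hj => h ⟨j, Nat.lt_succ_iff.2 hj⟩⟩
  rw [measure_eq_tsum_inter_fiber μ hmeas]
  have hR : ∑' x, taboo μ z k x * P x y = ∑' (b : Fin (k+1) → V) (x : V),
      μ ({ω | ω k = x ∧ ∀ j ≤ k, ω j ∉ z} ∩ (fun (ω : ℕ → V) (i : Fin (k+1)) => ω (i : ℕ)) ⁻¹' {b}) * P x y := by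
    rw [ENNReal.tsum_comm]
    refine tsum_congr fun x => ?_
    rw [ENNReal.tsum_mul_right, taboo, measure_eq_tsum_inter_fiber μ hmeas]
  rw [hR]
  refine tsum_congr fun b => ?_
  by_cases hb : ∀ i, b i ∉ z
  · rw [tsum_eq_single (b (Fin.last k))]
    · have h1 : {ω : ℕ → V | ω (k+1) = y ∧ ∀ j ≤ k, ω j ∉ z} ∩ (fun (ω : ℕ → V) (i : Fin (k+1)) => ω (i : ℕ)) ⁻¹' {b}
          = {ω | (∀ i : Fin (k+1), ω (i : ℕ) = b i) ∧ ω (k+1) = y} := by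
        ext ω
        simp only [Set.mem_inter_iff, Set.mem_ofPred_eq, Set.mem_preimage, Set.mem_singleton_iff]
        constructor
        · rintro ⟨⟨h, -⟩, h'⟩
          exact ⟨fun i => congrFun h' i, h⟩
        · rintro ⟨h, h'⟩
          exact ⟨⟨h', (hforall ω b (funext h)).2 hb⟩, funext h⟩
      have h2 : {ω : ℕ → V | ω k = b (Fin.last k) ∧ ∀ j ≤ k, ω j ∉ z} ∩
            (fun (ω : ℕ → V) (i : Fin (k+1)) => ω (i : ℕ)) ⁻¹' {b}
          = {ω | ∀ i : Fin (k+1), ω (i : ℕ) = b i} := by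
        ext ω
        simp only [Set.mem_inter_iff, Set.mem_ofPred_eq, Set.mem_preimage, Set.mem_singleton_iff]
        constructor
        · rintro ⟨-, h'⟩
          exact fun i => congrFun h' i
        · intro h
          exact ⟨⟨h (Fin.last k), (hforall ω b (funext h)).2 hb⟩, funext h⟩
      rw [h1, h2, hμ.measure_snoc]
    · intro x hx
      have : {ω : ℕ → V | ω k = x ∧ ∀ j ≤ k, ω j ∉ z} ∩ (fun (ω : ℕ → V) (i : Fin (k+1)) => ω (i : ℕ)) ⁻¹' {b} = ∅ := by
        ext ω
        simp only [Set.mem_inter_iff, Set.mem_ofPred_eq, Set.mem_preimage, Set.mem_singleton_iff,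
          Set.mem_empty_iff_false, iff_false]
        rintro ⟨⟨h, -⟩, h'⟩
        exact hx (h ▸ congrFun h' (Fin.last k))
      rw [this, measure_empty, zero_mul]
  · have hempty (p : (ℕ → V) → Prop) :
        {ω : ℕ → V | p ω ∧ ∀ j ≤ k, ω j ∉ z} ∩ (fun (ω : ℕ → V) (i : Fin (k+1)) => ω (i : ℕ)) ⁻¹' {b} = ∅ := by
      ext ω
      simp only [Set.mem_inter_iff, Set.mem_ofPred_eq, Set.mem_preimage, Set.mem_singleton_iff,
        Set.mem_empty_iff_false, iff_false]
      rintro ⟨⟨-, h⟩, h'⟩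
      exact hb ((hforall ω b h').1 h)
    simp [hempty]

lemma IsMarkovLaw.taboo_succ (hμ : IsMarkovLaw P o μ) {z : Set V} {y : V} (hy : y ∉ z) (k : ℕ) :
    taboo μ z (k+1) y = ∑' x, taboo μ z k x * P x y := by
  rw [← hμ.measure_step, taboo]
  congr 1
  ext ω
  simp only [Set.mem_ofPred_eq, and_congr_right_iff]
  rintro rfl
  refine ⟨fun h j hj => h j (hj.trans k.le_succ), fun h j hj => ?_⟩
  rcases Nat.le_succ_iff.1 hj with hj | rfl
  · exact h j hj
  · exact hy

lemma tsum_taboo_le [IsProbabilityMeasure μ] (z : Set V) (k : ℕ) : ∑' x, taboo μ z k x ≤ 1 := by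
  have h := measure_eq_tsum_inter_fiber μ (measurable_pi_apply k) {ω : ℕ → V | ∀ j ≤ k, ω j ∉ z}
  have h' : ∑' x, taboo μ z k x = μ {ω : ℕ → V | ∀ j ≤ k, ω j ∉ z} := by
    rw [h]
    refine tsum_congr fun x => ?_
    rw [taboo]
    congr 1
    ext ω
    simp [and_comm]
  rw [h']
  exact prob_le_one


lemma hitTime_eq_find {W : Type*} {z : Set W} {ω : ℕ → W} (h : ∃ k, ω k ∈ z) :
    hitTime z ω = (Nat.find h : ℝ≥0∞) := by
  refine le_antisymm (iInf₂_le (Nat.find h) (Nat.find_spec h)) (le_iInf₂ fun k hk => ?_)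
  exact_mod_cast Nat.find_min' h hk

lemma hitTime_eq_top {W : Type*} {z : Set W} {ω : ℕ → W} (h : ¬ ∃ k, ω k ∈ z) :
    hitTime z ω = ⊤ := by
  push Not at h
  simp [hitTime, h]

lemma lt_hitTime_iff {W : Type*} {z : Set W} {ω : ℕ → W} (k : ℕ) :
    (k : ℝ≥0∞) < hitTime z ω ↔ ∀ j ≤ k, ω j ∉ z := by
  by_cases h : ∃ k, ω k ∈ z
  · rw [hitTime_eq_find h, Nat.cast_lt, Nat.lt_find_iff]
  · rw [hitTime_eq_top h]
    push Not at h
    simp [h]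

lemma expNeg_natCast (lam : ℝ) (k : ℕ) :
    expNeg lam (k : ℝ≥0∞) = ENNReal.ofReal (Real.exp (-lam)) ^ k := by
  rw [expNeg, if_neg (ENNReal.natCast_ne_top k), ENNReal.toReal_natCast,
    ← ENNReal.ofReal_pow (Real.exp_pos _).le, ← Real.exp_nat_mul, mul_comm]

lemma expNeg_add_one (lam : ℝ) (t : ℝ≥0∞) :
    expNeg lam (t + 1) = ENNReal.ofReal (Real.exp (-lam)) * expNeg lam t := by
  by_cases ht : t = ⊤
  · simp [expNeg, ht]
  · rw [expNeg, expNeg, if_neg ht, if_neg (by simp [ht]), ENNReal.toReal_add ht (by simp),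
      ← ENNReal.ofReal_mul (Real.exp_pos _).le, ← Real.exp_add]
    simp only [ENNReal.toReal_one]
    ring_nf

lemma expNeg_hitTime {W : Type*} (lam : ℝ) (z : Set W) (ω : ℕ → W) :
    expNeg lam (hitTime z ω) = ∑' k, {ω : ℕ → W | ω k ∈ z ∧ ∀ j < k, ω j ∉ z}.indicator
      (fun _ => ENNReal.ofReal (Real.exp (-lam)) ^ k) ω := by
  by_cases h : ∃ k, ω k ∈ z
  · rw [hitTime_eq_find h, tsum_eq_single (Nat.find h), Set.indicator_of_mem, expNeg_natCast]
    · exact ⟨Nat.find_spec h, fun j hj => Nat.find_min h hj⟩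
    · intro k hk
      refine Set.indicator_of_notMem ?_ _
      rintro ⟨h1, h2⟩
      refine hk (le_antisymm ?_ (Nat.find_min' h h1))
      by_contra! hlt
      exact h2 _ hlt (Nat.find_spec h)
  · rw [hitTime_eq_top h, expNeg, if_pos rfl]
    push Not at h
    simp [h]

lemma measurableSet_eval_mem (z : Set V) (k : ℕ) : MeasurableSet {ω : ℕ → V | ω k ∈ z} :=
  measurable_pi_apply k z.to_countable.measurableSet

lemma measurableSet_firstHit (z : Set V) (k : ℕ) :
    MeasurableSet {ω : ℕ → V | ω k ∈ z ∧ ∀ j < k, ω j ∉ z} := by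
  have h : {ω : ℕ → V | ω k ∈ z ∧ ∀ j < k, ω j ∉ z} =
      {ω | ω k ∈ z} ∩ ⋂ j, ⋂ (_ : j < k), {ω | ω j ∈ z}ᶜ := by
    ext ω
    simp
  rw [h]
  exact (measurableSet_eval_mem z k).inter (MeasurableSet.iInter fun j =>
    MeasurableSet.iInter fun _ => (measurableSet_eval_mem z j).compl)

lemma measurable_expNeg_hitTime (lam : ℝ) (z : Set V) :
    Measurable fun ω : ℕ → V => expNeg lam (hitTime z ω) := by
  simp only [expNeg_hitTime]
  exact Measurable.tsum fun k => measurable_const.indicator (measurableSet_firstHit z k)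

lemma IsMarkovLaw.measure_firstHit_succ (hμ : IsMarkovLaw P o μ) (z : Set V) (k : ℕ) :
    μ {ω | ω (k+1) ∈ z ∧ ∀ j < k+1, ω j ∉ z} = ∑' x, taboo μ z k x * ∑' y : z, P x y := by
  rw [measure_eq_tsum_inter_fiber μ (measurable_pi_apply (k+1))]
  simp only [← ENNReal.tsum_mul_left]
  rw [ENNReal.tsum_comm, ← tsum_subtype_eq_of_support_subset (s := z)]
  · refine tsum_congr fun y => ?_
    rw [← hμ.measure_step]
    congr 1
    ext ω
    simp only [Nat.lt_succ_iff, Set.mem_inter_iff, Set.mem_ofPred_eq, Set.mem_preimage,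
      Set.mem_singleton_iff]
    constructor
    · rintro ⟨⟨-, h⟩, h'⟩
      exact ⟨h', h⟩
    · rintro ⟨h', h⟩
      exact ⟨⟨h' ▸ y.2, h⟩, h'⟩
  · intro y hy
    by_contra hyz
    refine hy ?_
    convert measure_empty (μ := μ)
    ext ω
    simp only [Set.mem_inter_iff, Set.mem_ofPred_eq, Set.mem_preimage, Set.mem_singleton_iff,
      Set.mem_empty_iff_false, iff_false]
    rintro ⟨⟨h, -⟩, rfl⟩
    exact hyz h

lemma IsMarkovLaw.lintegral_expNeg_hitTime (hμ : IsMarkovLaw P o μ) {z : Set V} (ho : o ∉ z)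
    (lam : ℝ) :
    ∫⁻ ω, expNeg lam (hitTime z ω) ∂μ = ∑' k : ℕ, ENNReal.ofReal (Real.exp (-lam)) ^ (k+1) *
      ∑' x, taboo μ z k x * ∑' y : z, P x y := by
  simp only [expNeg_hitTime]
  rw [lintegral_tsum fun k =>
    (measurable_const.indicator (measurableSet_firstHit z k)).aemeasurable]
  simp only [lintegral_indicator_const (measurableSet_firstHit z _)]
  rw [tsum_eq_zero_add' ENNReal.summable]
  have h0 : μ {ω | ω 0 ∈ z ∧ ∀ j < 0, ω j ∉ z} = 0 := by
    rw [measure_eq_tsum_inter_fiber μ (measurable_pi_apply 0), ENNReal.tsum_eq_zero]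
    intro x
    by_cases hx : x ∈ z
    · refine measure_mono_null (t := {ω | ω 0 = x}) (fun ω h => h.2) ?_
      rw [hμ.measure_init, if_neg]
      rintro rfl
      exact ho hx
    · convert measure_empty (μ := μ)
      ext ω
      simp only [Set.mem_inter_iff, Set.mem_ofPred_eq, Set.mem_preimage, Set.mem_singleton_iff,
        Set.mem_empty_iff_false, iff_false]
      rintro ⟨⟨h, -⟩, rfl⟩
      exact hx h
  rw [h0, mul_zero, zero_add]
  simp only [hμ.measure_firstHit_succ]

lemma lintegral_visitsBefore (μ : Measure (ℕ → V)) (z : Set V) (x : V) :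
    ∫⁻ ω, visitsBefore z x ω ∂μ = ∑' k, taboo μ z k x := by
  have hm (k : ℕ) : MeasurableSet {ω : ℕ → V | ω k = x ∧ ∀ j ≤ k, ω j ∉ z} := by
    have h : {ω : ℕ → V | ω k = x ∧ ∀ j ≤ k, ω j ∉ z} =
        {ω | ω k ∈ ({x} : Set V)} ∩ ⋂ j, ⋂ (_ : j ≤ k), {ω | ω j ∈ z}ᶜ := by
      ext ω
      simp
    rw [h]
    exact (measurableSet_eval_mem {x} k).inter (MeasurableSet.iInter fun j =>
      MeasurableSet.iInter fun _ => (measurableSet_eval_mem z j).compl)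
  have h (ω : ℕ → V) : visitsBefore z x ω =
      ∑' k, {ω : ℕ → V | ω k = x ∧ ∀ j ≤ k, ω j ∉ z}.indicator (fun _ => 1) ω := by
    simp only [visitsBefore, lt_hitTime_iff, Set.indicator_apply, Set.mem_ofPred_eq]
  simp only [h]
  rw [lintegral_tsum fun k => (measurable_const.indicator (hm k)).aemeasurable]
  simp only [lintegral_indicator_const (hm _), one_mul, taboo]

end MarkovLaw

section BiasedWalk

lemma biasedStep_tsum (g : ℝ) (x : ℤ) (W : ℤ → ℝ≥0∞) :
    ∑' y, biasedStep g x y * W y = ENNReal.ofReal (g / (g+1)) * W (x+1)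
      + ENNReal.ofReal (1 / (g+1)) * W (x-1) := by
  rw [tsum_eq_sum (s := {x+1, x-1}), Finset.sum_pair (by omega)]
  · have : x - 1 ≠ x + 1 := by omega
    simp [biasedStep, this]
  · intro y hy
    simp only [Finset.mem_insert, Finset.mem_singleton, not_or] at hy
    simp [biasedStep, hy.1, hy.2]

variable {g : ℝ} {ν : Measure (ℕ → ℤ)}

lemma biased_taboo_eq_zero (hν : IsMarkovLaw (biasedStep g) 0 ν) {n : ℕ} (hn : 1 ≤ n) (k : ℕ)
    {m : ℤ} (hm : (n : ℤ) ≤ m) : taboo ν {m : ℤ | m = (n : ℤ)} k m = 0 := by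
  have h0 : (0 : ℤ) ∉ {m : ℤ | m = (n : ℤ)} := by
    simp only [Set.mem_ofPred_eq]
    omega
  induction k generalizing m with
  | zero => rw [hν.taboo_zero h0, if_neg (by omega)]
  | succ k ih =>
    rcases hm.eq_or_lt with rfl | hm
    · exact taboo_of_mem (z := {m : ℤ | m = (n : ℤ)}) rfl _
    · rw [hν.taboo_succ (by simp only [Set.mem_ofPred_eq]; omega), ENNReal.tsum_eq_zero]
      intro x
      by_cases hx : (n : ℤ) ≤ x
      · rw [ih hx, zero_mul]
      · rw [biasedStep, if_neg (by omega), if_neg (by omega), mul_zero]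

/-- The hitting probability generating function of the biased walk dominates the powers of the
root of the one-step equation. -/
lemma pow_le_lintegral_biased (hν : IsMarkovLaw (biasedStep g) 0 ν) {n : ℕ} (hn : 1 ≤ n)
    (hg : 0 < g) {lam f : ℝ} (hlam : 0 < lam) (hf0 : 0 ≤ f) (hf1 : f ≤ 1)
    (hf : f = Real.exp (-lam) * (g / (g+1) + 1 / (g+1) * f^2)) :
    ENNReal.ofReal f ^ n ≤ ∫⁻ ω, expNeg lam (hitTime {m : ℤ | m = (n : ℤ)} ω) ∂ν := by
  have hprob : IsProbabilityMeasure ν := hν.1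
  set z : Set ℤ := {m : ℤ | m = (n : ℤ)} with hz
  set S : ℝ≥0∞ := ENNReal.ofReal (Real.exp (-lam)) with hS
  have hzmem (m : ℤ) : m ∈ z ↔ m = n := Iff.rfl
  have h0 : (0 : ℤ) ∉ z := by
    rw [hzmem]
    omega
  rw [hν.lintegral_expNeg_hitTime h0]
  set hit : ℕ → ℝ≥0∞ := fun k => ∑' x, taboo ν z k x * ∑' y : z, biasedStep g x y with hhit
  set W : ℤ → ℝ≥0∞ := fun m => ENNReal.ofReal f ^ ((n : ℤ) - m).toNat with hW
  set M : ℕ → ℝ≥0∞ := fun k => ∑' m, taboo ν z k m * W m with hM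
  have hsub (x : ℤ) : ∑' y : z, biasedStep g x y = biasedStep g x n := by
    have : z = {(n : ℤ)} := rfl
    rw [this]
    exact tsum_singleton (n : ℤ) (biasedStep g x)
  have hWle (m : ℤ) : W m ≤ 1 := pow_le_one₀ (zero_le) (by simpa using hf1)
  have hMle (k : ℕ) : M k ≤ 1 :=
    (ENNReal.tsum_le_tsum fun m => mul_le_of_le_one_right' (hWle m)).trans (tsum_taboo_le z k)
  have hWharm {x : ℤ} (hx : x < n) : W x = S * ∑' y, biasedStep g x y * W y := by
    obtain ⟨j, hj⟩ := Int.eq_ofNat_of_zero_le (show 0 ≤ (n : ℤ) - x - 1 by omega)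
    rw [biasedStep_tsum]
    have e0 : ((n : ℤ) - x).toNat = j + 1 := by omega
    have e1 : ((n : ℤ) - (x+1)).toNat = j := by omega
    have e2 : ((n : ℤ) - (x-1)).toNat = j + 2 := by omega
    simp only [hW, e0, e1, e2]
    rw [← ENNReal.ofReal_pow hf0, ← ENNReal.ofReal_pow hf0, ← ENNReal.ofReal_pow hf0,
      ← ENNReal.ofReal_mul (by positivity), ← ENNReal.ofReal_mul (by positivity),
      ← ENNReal.ofReal_add (by positivity) (by positivity), hS,
      ← ENNReal.ofReal_mul (by positivity)]
    congr 1
    rw [pow_succ]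
    nth_rewrite 2 [hf]
    ring
  have hstep (k : ℕ) : M k = S * (hit k + M (k+1)) := by
    have h1 : M k = S * ∑' x, ∑' y, taboo ν z k x * (biasedStep g x y * W y) := by
      rw [← ENNReal.tsum_mul_left]
      refine tsum_congr fun x => ?_
      rw [ENNReal.tsum_mul_left]
      rcases lt_or_ge x n with hx | hx
      · rw [hWharm hx]
        ring
      · rw [biased_taboo_eq_zero hν hn k hx]
        simp
    rw [h1, ENNReal.tsum_comm]
    congr 1
    have h2 (y : ℤ) : ∑' x, taboo ν z k x * (biasedStep g x y * W y)
        = (if y = n then hit k else 0) + taboo ν z (k+1) y * W y := by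
      simp only [← mul_assoc]
      rw [ENNReal.tsum_mul_right]
      by_cases hy : y = n
      · subst hy
        simp [hhit, hsub, hW, taboo_of_mem ((hzmem _).2 rfl)]
      · rw [if_neg hy, zero_add, hν.taboo_succ (by rwa [hzmem])]
    simp only [h2]
    rw [ENNReal.tsum_add, tsum_ite_eq]
  have hind (k : ℕ) : M 0 = ∑ j ∈ Finset.range k, S ^ (j+1) * hit j + S ^ k * M k := by
    induction k with
    | zero => simp
    | succ k ih =>
      rw [ih, Finset.sum_range_succ, hstep k]
      ring
  have hM0 : M 0 = ENNReal.ofReal f ^ n := by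
    simp only [hM, hν.taboo_zero h0]
    rw [tsum_eq_single 0 (by simp +contextual)]
    simp [hW]
  have hS1 : S < 1 := by
    rw [hS, ENNReal.ofReal_lt_one, Real.exp_lt_one_iff]
    linarith
  have hlim : Filter.Tendsto (fun k => (∑' j, S ^ (j+1) * hit j) + S ^ k) Filter.atTop
      (nhds ((∑' j, S ^ (j+1) * hit j) + 0)) :=
    tendsto_const_nhds.add (ENNReal.tendsto_pow_atTop_nhds_zero_of_lt_one hS1)
  rw [add_zero] at hlim
  refine ge_of_tendsto' hlim fun k => ?_
  rw [← hM0, hind k]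
  exact add_le_add (ENNReal.sum_le_tsum _) (mul_le_of_le_one_right' (hMle k))

end BiasedWalk

section RealInequalities

lemma exists_root {g s : ℝ} (hg : 1 < g) (hs0 : 0 < s) (hs1 : s < 1) :
    ∃ f, 0 < f ∧ f < 1 ∧ f = s * (g / (g+1) + 1 / (g+1) * f^2) := by
  have hc : ContinuousOn (fun f : ℝ => s * (g + f^2) - (g+1) * f) (Set.Icc 0 1) := by fun_prop
  obtain ⟨f, hf, h⟩ := intermediate_value_Ioo' zero_le_one hc
    (show (0 : ℝ) ∈ Set.Ioo _ _ by constructor <;> norm_num <;> nlinarith)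
  refine ⟨f, hf.1, hf.2, ?_⟩
  field_simp
  simp only at h
  linarith

lemma rpow_mul_sub_le {s y₀ y p : ℝ} (hs1 : s < 1) (hy₀ : 0 < y₀) (hy₀s : y₀ < s) (hy : 0 < y)
    (hys : y < s) (hp : p = y₀ * (1 - s^2) / ((s - y₀) * (1 - s * y₀))) :
    y ^ p * (s - y) * (1 - s * y₀) ≤ y₀ ^ p * (s - y₀) * (1 - s * y) := by
  have a1 : 0 < s - y₀ := by linarith
  have a2 : 0 < s - y := by linarith
  have a3 : 0 < 1 - s * y₀ := by nlinarith
  have a4 : 0 < 1 - s * y := by nlinarith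
  have a5 : 0 < 1 - s^2 := by nlinarith
  have hp0 : 0 ≤ p := by rw [hp]; positivity
  have h1 : p * Real.log (y / y₀) ≤ (1 - s^2) * (y - y₀) / ((s - y₀) * (1 - s * y₀)) := by
    have := mul_le_mul_of_nonneg_left (Real.log_le_sub_one_of_pos (div_pos hy hy₀)) hp0
    refine this.trans_eq ?_
    rw [hp]
    field_simp
  have h2 : (1 - s^2) * (y - y₀) / ((s - y₀) * (1 - s * y)) ≤
      Real.log ((s - y₀) * (1 - s * y) / ((s - y) * (1 - s * y₀))) := by
    have := Real.one_sub_inv_le_log_of_pos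
      (show 0 < (s - y₀) * (1 - s * y) / ((s - y) * (1 - s * y₀)) by positivity)
    refine Eq.trans_le ?_ this
    field_simp
    ring
  have h3 : (1 - s^2) * (y - y₀) / ((s - y₀) * (1 - s * y₀)) ≤
      (1 - s^2) * (y - y₀) / ((s - y₀) * (1 - s * y)) := by
    rw [div_le_div_iff₀ (by positivity) (by positivity)]
    have : 0 ≤ (1 - s^2) * (s - y₀) * (s * (y - y₀)^2) := by
      have : 0 < s := by linarith
      positivity
    nlinarith
  have h4 := h1.trans (h3.trans h2)
  rw [← Real.log_rpow (div_pos hy hy₀), Real.log_le_log_iff (by positivity) (by positivity),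
    Real.div_rpow hy.le hy₀.le, div_le_div_iff₀ (by positivity) (by positivity)] at h4
  nlinarith

/-- The edge inequality in ratio form. -/
lemma edge_ratio {s y₀ y p E : ℝ} (hs0 : 0 < s) (hs1 : s < 1) (hy₀ : 0 < y₀) (hy₀s : y₀ < s)
    (hy : 0 < y) (hp : p = y₀ * (1 - s^2) / ((s - y₀) * (1 - s * y₀)))
    (hE : E * (y₀ ^ p * (s - y₀)) = 1 - s * y₀) :
    s * (y + E * y ^ p) ≤ 1 + E * y ^ (p+1) := by
  have a1 : 0 < s - y₀ := by linarith
  have a3 : 0 < 1 - s * y₀ := by nlinarith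
  have a5 : 0 < 1 - s^2 := by nlinarith
  have hp0 : 0 ≤ p := by rw [hp]; positivity
  have hy0p : 0 < y₀ ^ p := Real.rpow_pos_of_pos hy₀ p
  have hEpos : 0 < E := by
    by_contra! h
    have : E * (y₀ ^ p * (s - y₀)) ≤ 0 := mul_nonpos_of_nonpos_of_nonneg h (by positivity)
    linarith
  have hyp : 0 < y ^ p := Real.rpow_pos_of_pos hy p
  rw [Real.rpow_add_one hy.ne']
  suffices h : E * (y ^ p * (s - y)) ≤ 1 - s * y by nlinarith
  rcases lt_or_ge y s with hys | hys
  · have h := rpow_mul_sub_le hs1 hy₀ hy₀s hy hys hp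
    have h2 := mul_le_mul_of_nonneg_left h hEpos.le
    have e : E * (y₀ ^ p * (s - y₀) * (1 - s * y)) = (1 - s * y₀) * (1 - s * y) := by
      rw [← hE]; ring
    rw [e] at h2
    refine le_of_mul_le_mul_left ?_ a3
    nlinarith
  · rcases le_or_gt y 1 with hy1 | hy1
    · have : E * (y ^ p * (s - y)) ≤ 0 :=
        mul_nonpos_of_nonneg_of_nonpos hEpos.le
          (mul_nonpos_of_nonneg_of_nonpos hyp.le (by linarith))
      nlinarith
    · have hE1 : 1 ≤ E := by
        have : y₀ ^ p ≤ 1 := Real.rpow_le_one hy₀.le (by linarith) hp0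
        have h5 : y₀ ^ p * (s - y₀) ≤ 1 - s * y₀ := by nlinarith
        rw [← hE] at h5
        have : 0 < y₀ ^ p * (s - y₀) := by positivity
        by_contra! h
        nlinarith
      have hyp1 : 1 ≤ y ^ p := Real.one_le_rpow hy1.le hp0
      have : 1 ≤ E * y ^ p := by nlinarith
      nlinarith

/-- The edge inequality between neighbouring levels. -/
lemma edge_up {s y₀ p E a b : ℝ} (hs0 : 0 < s) (hs1 : s < 1) (hy₀ : 0 < y₀) (hy₀s : y₀ < s)
    (hp : p = y₀ * (1 - s^2) / ((s - y₀) * (1 - s * y₀)))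
    (hE : E * (y₀ ^ p * (s - y₀)) = 1 - s * y₀) (hp0 : 0 < p) (hE0 : 0 ≤ E)
    (ha : 0 ≤ a) (hb : 0 ≤ b) :
    s * (a ^ p * b + E * (b ^ p * a)) ≤ a ^ (p+1) + E * b ^ (p+1) := by
  rcases ha.eq_or_lt with rfl | ha
  · rw [Real.zero_rpow hp0.ne', Real.zero_rpow (by linarith)]
    simp
    positivity
  rcases hb.eq_or_lt with rfl | hb
  · rw [Real.zero_rpow hp0.ne', Real.zero_rpow (by linarith)]
    simp
    positivity
  have h := mul_le_mul_of_nonneg_left (edge_ratio hs0 hs1 hy₀ hy₀s (div_pos hb ha) hp hE)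
    (Real.rpow_nonneg ha.le (p+1))
  rw [Real.div_rpow hb.le ha.le, Real.div_rpow hb.le ha.le] at h
  have hap : 0 < a ^ p := Real.rpow_pos_of_pos ha p
  rw [Real.rpow_add_one ha.ne', Real.rpow_add_one hb.ne'] at h ⊢
  have e1 : a ^ p * a * (s * (b / a + E * (b ^ p / a ^ p))) = s * (a ^ p * b + E * (b ^ p * a)) := by
    field_simp
  have e2 : a ^ p * a * (1 + E * (b ^ p * b / (a ^ p * a))) = a ^ p * a + E * (b ^ p * b) := by
    field_simp
  rwa [e1, e2] at h

/-- The edge inequality inside a level. -/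
lemma edge_flat {s p a b : ℝ} (hs0 : 0 < s) (hs1 : s < 1) (hp0 : 0 < p)
    (ha : 0 ≤ a) (hb : 0 ≤ b) :
    s * (a ^ p * b + b ^ p * a) ≤ a ^ (p+1) + b ^ (p+1) := by
  rw [Real.rpow_add_one' ha (by linarith), Real.rpow_add_one' hb (by linarith)]
  have h1 : 0 ≤ (a ^ p - b ^ p) * (a - b) := by
    rcases le_total a b with h | h
    · exact mul_nonneg_of_nonpos_of_nonpos
        (sub_nonpos.2 (Real.rpow_le_rpow ha h hp0.le)) (sub_nonpos.2 h)
    · exact mul_nonneg (sub_nonneg.2 (Real.rpow_le_rpow hb h hp0.le)) (sub_nonneg.2 h)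
  have h2 : 0 ≤ a ^ p * b + b ^ p * a := by positivity
  nlinarith

end RealInequalities

section GreenFunction

/-- Hölder's inequality for weighted sums. -/
lemma tsum_mul_le_holder {ι : Type*} (h f : ι → ℝ≥0∞) {p : ℝ} (hp : 0 < p) :
    ∑' x, h x * f x ≤
      (∑' x, h x) ^ (p / (p+1)) * (∑' x, h x * f x ^ (p+1)) ^ (1 / (p+1)) := by
  let _ : MeasurableSpace ι := ⊤
  have hpq : ((p+1)/p).HolderConjugate (p+1) := by
    rw [Real.holderConjugate_iff]
    constructor
    · rw [lt_div_iff₀ hp]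
      linarith
    · field_simp
  have key := ENNReal.lintegral_mul_le_Lp_mul_Lq Measure.count hpq
    (f := fun x => h x ^ (p / (p+1))) (g := fun x => h x ^ (1 / (p+1)) * f x)
    measurable_from_top.aemeasurable measurable_from_top.aemeasurable
  simp only [lintegral_count, Pi.mul_apply] at key
  have e1 (x : ι) : h x ^ (p / (p+1)) * (h x ^ (1 / (p+1)) * f x) = h x * f x := by
    rw [← mul_assoc, ← ENNReal.rpow_add_of_nonneg _ _ (by positivity) (by positivity)]
    rw [show p / (p+1) + 1 / (p+1) = 1 by field_simp, ENNReal.rpow_one]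
  have e2 (x : ι) : (h x ^ (p / (p+1))) ^ ((p+1) / p) = h x := by
    rw [← ENNReal.rpow_mul, show p / (p+1) * ((p+1) / p) = 1 by field_simp, ENNReal.rpow_one]
  have e3 (x : ι) : (h x ^ (1 / (p+1)) * f x) ^ (p+1) = h x * f x ^ (p+1) := by
    rw [ENNReal.mul_rpow_of_nonneg _ _ (by positivity), ← ENNReal.rpow_mul,
      show 1 / (p+1) * (p+1) = 1 by field_simp, ENNReal.rpow_one]
  simp only [e1, e2, e3] at key
  rwa [show 1 / ((p+1) / p) = p / (p+1) by field_simp] at key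

namespace WeightedGraph

variable (G : WeightedGraph V)

lemma vw_ne_zero (x : V) : G.vw x ≠ 0 := (G.vw_pos x).ne'

lemma vw_ne_top (x : V) : G.vw x ≠ ⊤ := (G.vw_lt_top x).ne

/-- The graph distance from `o`, truncated at `n`. -/
noncomputable def level (o : V) (n : ℕ) (x : V) : ℕ :=
  sInf {k | k = n ∨ ∃ p : ℕ → V, p 0 = o ∧ (∀ i, i < k → 0 < G.w (p i) (p (i+1))) ∧ p k = x}

variable {G} {o : V} {n : ℕ}

lemma level_mem (x : V) : G.level o n x = n ∨ ∃ p : ℕ → V, p 0 = o ∧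
    (∀ i, i < G.level o n x → 0 < G.w (p i) (p (i+1))) ∧ p (G.level o n x) = x :=
  Nat.sInf_mem (s := {k | k = n ∨ ∃ p : ℕ → V, p 0 = o ∧
    (∀ i, i < k → 0 < G.w (p i) (p (i+1))) ∧ p k = x}) ⟨n, Or.inl rfl⟩

lemma level_le (x : V) : G.level o n x ≤ n := Nat.sInf_le (Or.inl rfl)

lemma level_self : G.level o n o = 0 :=
  Nat.le_zero.1 (Nat.sInf_le (Or.inr ⟨fun _ => o, rfl, by simp, rfl⟩))

lemma exists_path_succ {k : ℕ} {p : ℕ → V} (hp0 : p 0 = o)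
    (hp : ∀ i, i < k → 0 < G.w (p i) (p (i+1))) {y : V} (hy : 0 < G.w (p k) y) :
    ∃ p' : ℕ → V, p' 0 = o ∧ (∀ i, i < k+1 → 0 < G.w (p' i) (p' (i+1))) ∧ p' (k+1) = y := by
  refine ⟨fun i => if i ≤ k then p i else y, by simpa using hp0, fun i hi => ?_, by simp⟩
  rcases (Nat.lt_succ_iff.1 hi).eq_or_lt with rfl | hik
  · simpa using hy
  · simpa [hik.le, Nat.succ_le_of_lt hik] using hp i hik

lemma level_le_add_one {x y : V} (h : 0 < G.w x y) : G.level o n y ≤ G.level o n x + 1 := by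
  rcases level_mem (G := G) (o := o) (n := n) x with hx | ⟨p, hp0, hp, hpk⟩
  · exact (level_le y).trans (by omega)
  · exact Nat.sInf_le (Or.inr (exists_path_succ hp0 hp (by rwa [hpk])))

lemma level_eq_of_distGE {z : Set V} (hdist : G.distGE o z (n+1)) {x y : V} (hy : y ∈ z)
    (h : 0 < G.w x y) : G.level o n x = n := by
  rcases level_mem (G := G) (o := o) (n := n) x with hx | ⟨p, hp0, hp, hpk⟩
  · exact hx
  · obtain ⟨p', h0, h1, h2⟩ := exists_path_succ (y := y) hp0 hp (by rwa [hpk])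
    have := hdist _ p' h0 h1 (by rwa [h2])
    exact le_antisymm (level_le x) (by omega)

lemma tsum_boundary (z : Set V) : ∑' x, ∑' y : z, G.w x y = G.setWeight z := by
  rw [ENNReal.tsum_comm, setWeight]
  refine tsum_congr fun y => ?_
  rw [vw]
  exact tsum_congr fun x => G.symm x y

end WeightedGraph

variable [MeasurableSpace V]

/-- The Green function of the walk killed on `z` and at rate `S`, with respect to the vertex
weights. -/
noncomputable def green (G : WeightedGraph V) (μ : Measure (ℕ → V)) (z : Set V) (S : ℝ≥0∞)
    (x : V) : ℝ≥0∞ :=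
  ∑' k, S ^ k * (taboo μ z k x / G.vw x)

variable {G : WeightedGraph V} {μ : Measure (ℕ → V)} {z : Set V} {S : ℝ≥0∞} {o : V}

lemma green_of_mem {x : V} (hx : x ∈ z) : green G μ z S x = 0 := by
  simp [green, taboo_of_mem hx]

lemma vw_mul_green (x : V) : G.vw x * green G μ z S x = ∑' k, S ^ k * taboo μ z k x := by
  rw [green, ← ENNReal.tsum_mul_left]
  refine tsum_congr fun k => ?_
  rw [mul_left_comm, ENNReal.mul_div_cancel (G.vw_ne_zero x) (G.vw_ne_top x)]

variable [Countable V] [MeasurableSingletonClass V]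

lemma green_le_resistance (hS : S ≤ 1) : green G μ z S o ≤ resistance G o z μ := by
  rw [resistance, lintegral_visitsBefore, ENNReal.div_eq_inv_mul, ← ENNReal.tsum_mul_left, green]
  refine ENNReal.tsum_le_tsum fun k => ?_
  rw [ENNReal.div_eq_inv_mul]
  exact mul_le_of_le_one_left' (pow_le_one₀ (zero_le) hS)

lemma taboo_div_vw_le (hμ : IsMarkovLaw G.trans o μ) (ho : o ∉ z) (k : ℕ) (x : V) :
    taboo μ z k x / G.vw x ≤ (G.vw o)⁻¹ := by
  induction k generalizing x with
  | zero =>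
    rw [hμ.taboo_zero ho]
    split_ifs with h
    · rw [h, one_div]
    · simp
  | succ k ih =>
    by_cases hx : x ∈ z
    · simp [taboo_of_mem hx]
    · rw [hμ.taboo_succ hx, ENNReal.div_le_iff (G.vw_ne_zero x) (G.vw_ne_top x),
        WeightedGraph.vw, WeightedGraph.vw, ← ENNReal.tsum_mul_left]
      refine ENNReal.tsum_le_tsum fun y => ?_
      have h1 : taboo μ z k y * G.trans y x = taboo μ z k y / G.vw y * G.w y x := by
        rw [WeightedGraph.trans, ENNReal.div_eq_inv_mul, ENNReal.div_eq_inv_mul]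
        ring
      rw [h1, G.symm y x]
      exact mul_le_mul_left (ih y) _

lemma green_le (hμ : IsMarkovLaw G.trans o μ) (ho : o ∉ z) (x : V) :
    green G μ z S x ≤ (1 - S)⁻¹ * (G.vw o)⁻¹ := by
  rw [green, ← ENNReal.tsum_geometric, ← ENNReal.tsum_mul_right]
  exact ENNReal.tsum_le_tsum fun k => mul_le_mul_right (taboo_div_vw_le hμ ho k x) _

lemma green_ne_top (hμ : IsMarkovLaw G.trans o μ) (ho : o ∉ z) (hS : S < 1) (x : V) :
    green G μ z S x ≠ ⊤ :=
  ne_top_of_le_ne_top (ENNReal.mul_ne_top (ENNReal.inv_ne_top.2 (tsub_pos_of_lt hS).ne')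
    (ENNReal.inv_ne_top.2 (G.vw_ne_zero o))) (green_le hμ ho x)

lemma tsum_vw_mul_green_rpow_ne_top (hμ : IsMarkovLaw G.trans o μ) (ho : o ∉ z) (hS : S < 1)
    {p : ℝ} (hp : 0 < p) : ∑' x, G.vw x * green G μ z S x ^ (p+1) ≠ ⊤ := by
  have hprob : IsProbabilityMeasure μ := hμ.1
  have hgeom : (1 - S)⁻¹ ≠ ⊤ := ENNReal.inv_ne_top.2 (tsub_pos_of_lt hS).ne'
  have h1 : ∑' x, G.vw x * green G μ z S x ≤ (1 - S)⁻¹ := by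
    simp only [vw_mul_green]
    rw [ENNReal.tsum_comm, ← ENNReal.tsum_geometric]
    refine ENNReal.tsum_le_tsum fun k => ?_
    rw [ENNReal.tsum_mul_left]
    exact mul_le_of_le_one_right' (tsum_taboo_le z k)
  have h2 : ∑' x, G.vw x * green G μ z S x ^ (p+1) ≤
      (1 - S)⁻¹ * ((1 - S)⁻¹ * (G.vw o)⁻¹) ^ p := by
    refine le_trans ?_ (mul_le_mul_left h1 _)
    rw [← ENNReal.tsum_mul_right]
    refine ENNReal.tsum_le_tsum fun x => ?_
    rw [add_comm p 1, ENNReal.rpow_add_of_nonneg _ _ zero_le_one hp.le, ENNReal.rpow_one, mul_assoc]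
    exact mul_le_mul_right (mul_le_mul_right (ENNReal.rpow_le_rpow (green_le hμ ho x) hp.le) _) _
  refine ne_top_of_le_ne_top (ENNReal.mul_ne_top hgeom (ENNReal.rpow_ne_top_of_nonneg hp.le
    (ENNReal.mul_ne_top hgeom ?_))) h2
  simpa using G.vw_ne_zero o

/-- The Green function solves the killed Poisson equation with a point source at `o`. -/
lemma vw_mul_green_eq (hμ : IsMarkovLaw G.trans o μ) (ho : o ∉ z) {x : V} (hx : x ∉ z) :
    G.vw x * green G μ z S x
      = (if x = o then 1 else 0) + S * ∑' y, G.w x y * green G μ z S y := by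
  rw [vw_mul_green, tsum_eq_zero_add' ENNReal.summable, hμ.taboo_zero ho, pow_zero, one_mul]
  congr 1
  simp only [green, ← ENNReal.tsum_mul_left]
  rw [ENNReal.tsum_comm]
  refine tsum_congr fun k => ?_
  rw [hμ.taboo_succ hx, ← ENNReal.tsum_mul_left]
  refine tsum_congr fun y => ?_
  rw [WeightedGraph.trans, G.symm y x, pow_succ, ENNReal.div_eq_inv_mul, ENNReal.div_eq_inv_mul]
  ring

/-- The generating function of the hitting time in terms of the Green function. -/
lemma lintegral_expNeg_hitTime_eq_green (hμ : IsMarkovLaw G.trans o μ) (ho : o ∉ z) (lam : ℝ) :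
    ∫⁻ ω, expNeg lam (hitTime z ω) ∂μ = ENNReal.ofReal (Real.exp (-lam)) *
      ∑' x, (∑' y : z, G.w x y) * green G μ z (ENNReal.ofReal (Real.exp (-lam))) x := by
  rw [hμ.lintegral_expNeg_hitTime ho]
  simp only [green, ← ENNReal.tsum_mul_left, ← ENNReal.tsum_mul_right]
  rw [ENNReal.tsum_comm]
  refine tsum_congr fun x => ?_
  refine tsum_congr fun k => tsum_congr fun y => ?_
  rw [WeightedGraph.trans, pow_succ, ENNReal.div_eq_inv_mul, ENNReal.div_eq_inv_mul]
  ring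

/-- A weighted `L^{p+1}` bound for the Green function on the boundary of `z`. -/
lemma tsum_boundary_green_rpow_le (hμ : IsMarkovLaw G.trans o μ) (ho : o ∉ z) (hS : S < 1)
    {p : ℝ} (hp : 0 < p) {e : V → ℝ≥0∞} {K : ℝ≥0∞} (heK : ∀ x, e x ≤ K) (hK : K ≠ ⊤)
    (heo : e o = 1)
    (hedge : ∀ x y, 0 < G.w x y → ∀ a b : ℝ≥0∞, a ≠ ⊤ → b ≠ ⊤ →
      S * (e x * (a ^ p * b) + e y * (b ^ p * a)) ≤ e x * a ^ (p+1) + e y * b ^ (p+1)) :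
    ∑' x, (∑' y : z, G.w x y) * (e x * green G μ z S x ^ (p+1)) ≤ green G μ z S o ^ p := by
  set η := green G μ z S with hη
  have hp1 : 0 < p + 1 := by linarith
  have hηz (x : V) (hx : x ∈ z) : η x = 0 := green_of_mem hx
  set D : ℝ≥0∞ := ∑' x, ∑' y, G.w x y * (e x * (η x ^ p * η y)) with hD
  set c : V → V → ℝ≥0∞ := fun x y => if y ∈ z then 0 else G.w x y with hc
  set B : ℝ≥0∞ := ∑' x, ∑' y, c x y * (e x * η x ^ (p+1)) with hB
  set C : ℝ≥0∞ := ∑' x, (∑' y : z, G.w x y) * (e x * η x ^ (p+1)) with hC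
  have hsplit (x : V) : G.vw x = ∑' y, c x y + ∑' y : z, G.w x y := by
    rw [tsum_subtype z (G.w x), ← ENNReal.tsum_add, WeightedGraph.vw]
    refine tsum_congr fun y => ?_
    by_cases hy : y ∈ z <;> simp [hc, hy]
  have hA1 : ∑' x, G.vw x * (e x * η x ^ (p+1)) = B + C := by
    rw [hB, hC, ← ENNReal.tsum_add]
    refine tsum_congr fun x => ?_
    rw [hsplit, add_mul, ENNReal.tsum_mul_right]
  have hA2 : ∑' x, G.vw x * (e x * η x ^ (p+1)) = η o ^ p + S * D := by
    have h1 (x : V) : G.vw x * (e x * η x ^ (p+1)) =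
        (if x = o then η o ^ p else 0) + S * ∑' y, G.w x y * (e x * (η x ^ p * η y)) := by
      by_cases hx : x ∈ z
      · have hxo : x ≠ o := by
          rintro rfl
          exact ho hx
        simp [hηz x hx, hp, hp1, hxo]
      · rw [ENNReal.rpow_add_of_nonneg _ _ hp.le zero_le_one, ENNReal.rpow_one]
        have h2 : G.vw x * (e x * (η x ^ p * η x)) = e x * η x ^ p * (G.vw x * η x) := by ring
        rw [h2, vw_mul_green_eq hμ ho hx, mul_add]
        congr 1
        · split_ifs with hxo
          · rw [hxo, heo, one_mul, mul_one]
          · rw [mul_zero]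
        · rw [mul_left_comm, ← ENNReal.tsum_mul_left]
          congr 1
          refine tsum_congr fun y => ?_
          ring
    simp only [h1]
    rw [ENNReal.tsum_add, tsum_ite_eq, ENNReal.tsum_mul_left]
  have hDswap : D = ∑' x, ∑' y, G.w x y * (e y * (η y ^ p * η x)) := by
    rw [hD, ENNReal.tsum_comm]
    exact tsum_congr fun x => tsum_congr fun y => by rw [G.symm]
  have hBswap : B = ∑' x, ∑' y, c y x * (e y * η y ^ (p+1)) := by
    rw [hB, ENNReal.tsum_comm]
  have hDB : S * D ≤ B := by
    have h2 : S * D + S * D ≤ B + B := by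
      nth_rewrite 2 [hDswap]
      nth_rewrite 2 [hBswap]
      rw [hD, hB]
      simp only [← ENNReal.tsum_mul_left, ← ENNReal.tsum_add]
      refine ENNReal.tsum_le_tsum fun x => ENNReal.tsum_le_tsum fun y => ?_
      by_cases hx : x ∈ z
      · simp [hηz x hx, hp]
      by_cases hy : y ∈ z
      · simp [hηz y hy, hp]
      simp only [hc, if_neg hx, if_neg hy, G.symm y x]
      rcases eq_zero_or_pos (G.w x y) with hw | hw
      · simp [hw]
      · have h3 := hedge x y hw (η x) (η y) (green_ne_top hμ ho hS x) (green_ne_top hμ ho hS y)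
        calc _ = G.w x y * (S * (e x * (η x ^ p * η y) + e y * (η y ^ p * η x))) := by ring
          _ ≤ G.w x y * (e x * η x ^ (p+1) + e y * η y ^ (p+1)) := mul_le_mul_right h3 _
          _ = _ := by ring
    by_contra! h
    exact absurd h2 (not_le.2 (ENNReal.add_lt_add h h))
  have hBtop : B ≠ ⊤ := by
    refine ne_top_of_le_ne_top (ENNReal.mul_ne_top hK
      (tsum_vw_mul_green_rpow_ne_top hμ ho hS hp)) ((le_self_add.trans_eq hA1.symm).trans ?_)
    rw [← ENNReal.tsum_mul_left]
    refine ENNReal.tsum_le_tsum fun x => ?_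
    rw [mul_left_comm]
    exact mul_le_mul_left (heK x) _
  have hfin : B + C ≤ B + η o ^ p := by
    rw [← hA1, hA2, add_comm]
    exact add_le_add_left hDB _
  exact (ENNReal.add_le_add_iff_left hBtop).1 hfin

end GreenFunction

lemma ennreal_edge {s y₀ p E : ℝ} (hs0 : 0 < s) (hs1 : s < 1) (hy₀ : 0 < y₀) (hy₀s : y₀ < s)
    (hp : p = y₀ * (1 - s^2) / ((s - y₀) * (1 - s * y₀)))
    (hE : E * (y₀ ^ p * (s - y₀)) = 1 - s * y₀) (hp0 : 0 < p) (hE0 : 0 ≤ E) {i j : ℕ}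
    (hij : i ≤ j + 1) (hji : j ≤ i + 1) {a b : ℝ≥0∞} (ha : a ≠ ⊤) (hb : b ≠ ⊤) :
    ENNReal.ofReal s * (ENNReal.ofReal E ^ i * (a ^ p * b) + ENNReal.ofReal E ^ j * (b ^ p * a))
      ≤ ENNReal.ofReal E ^ i * a ^ (p+1) + ENNReal.ofReal E ^ j * b ^ (p+1) := by
  have key : ∀ a b : ℝ, 0 ≤ a → 0 ≤ b →
      s * (E ^ i * (a ^ p * b) + E ^ j * (b ^ p * a)) ≤ E ^ i * a ^ (p+1) + E ^ j * b ^ (p+1) := by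
    intro a b ha hb
    rcases (show j = i ∨ j = i + 1 ∨ i = j + 1 by omega) with rfl | rfl | rfl
    · have := mul_le_mul_of_nonneg_left (edge_flat hs0 hs1 hp0 ha hb) (pow_nonneg hE0 j)
      linarith
    · have := mul_le_mul_of_nonneg_left (edge_up hs0 hs1 hy₀ hy₀s hp hE hp0 hE0 ha hb)
        (pow_nonneg hE0 i)
      rw [pow_succ]
      linarith
    · have := mul_le_mul_of_nonneg_left (edge_up hs0 hs1 hy₀ hy₀s hp hE hp0 hE0 hb ha)
        (pow_nonneg hE0 j)
      rw [pow_succ]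
      linarith
  have h := ENNReal.ofReal_le_ofReal (key a.toReal b.toReal ENNReal.toReal_nonneg
    ENNReal.toReal_nonneg)
  have ha0 : 0 ≤ a.toReal := ENNReal.toReal_nonneg
  have hb0 : 0 ≤ b.toReal := ENNReal.toReal_nonneg
  have hp1 : 0 ≤ p + 1 := by linarith
  rw [ENNReal.ofReal_mul hs0.le, ENNReal.ofReal_add (by positivity) (by positivity),
    ENNReal.ofReal_add (by positivity) (by positivity),
    ENNReal.ofReal_mul (by positivity), ENNReal.ofReal_mul (by positivity),
    ENNReal.ofReal_mul (by positivity), ENNReal.ofReal_mul (by positivity),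
    ENNReal.ofReal_mul (by positivity), ENNReal.ofReal_mul (by positivity),
    ENNReal.ofReal_pow hE0, ENNReal.ofReal_pow hE0, ← ENNReal.ofReal_rpow_of_nonneg ha0 hp0.le,
    ← ENNReal.ofReal_rpow_of_nonneg ha0 hp1, ← ENNReal.ofReal_rpow_of_nonneg hb0 hp0.le,
    ← ENNReal.ofReal_rpow_of_nonneg hb0 hp1, ENNReal.ofReal_toReal ha,
    ENNReal.ofReal_toReal hb] at h
  exact h

lemma lintegral_expNeg_hitTime_le [Countable V] [MeasurableSpace V] [MeasurableSingletonClass V]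
    {G : WeightedGraph V} {o : V} {z : Set V} {n : ℕ} {g : ℝ} {μ : Measure (ℕ → V)}
    (hμ : IsMarkovLaw G.trans o μ) (hdist : G.distGE o z (n + 1))
    (hgn : G.setWeight z * resistance G o z μ = ENNReal.ofReal g ^ n) (hg : 1 < g)
    {lam f : ℝ} (hlam : 0 < lam) (hf0 : 0 < f) (hf1 : f < 1)
    (hf : f = Real.exp (-lam) * (g / (g+1) + 1 / (g+1) * f^2)) :
    ∫⁻ ω, expNeg lam (hitTime z ω) ∂μ
      ≤ ENNReal.ofReal (Real.exp (-lam)) * ENNReal.ofReal f ^ n := by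
  have ho : o ∉ z := fun h => absurd (hdist 0 (fun _ => o) rfl (by simp) h) (by omega)
  rw [lintegral_expNeg_hitTime_eq_green hμ ho]
  set s : ℝ := Real.exp (-lam) with hs
  have hs0 : 0 < s := Real.exp_pos _
  have hs1 : s < 1 := by
    rw [hs, Real.exp_lt_one_iff]
    linarith
  have hg0 : 0 < g := by linarith
  have hS : ENNReal.ofReal s < 1 := by rwa [ENNReal.ofReal_lt_one]
  refine mul_le_mul_right ?_ _
  set y₀ : ℝ := f / g with hy₀def
  have hy₀ : 0 < y₀ := by positivity
  have hfy : f = g * y₀ := by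
    rw [hy₀def]
    field_simp
  have hy₀1 : y₀ < 1 := by
    rw [hy₀def, div_lt_one hg0]
    linarith
  have hsy : 0 < 1 - s * y₀ := by nlinarith
  have hroot : s - y₀ = g * y₀ * (1 - s * y₀) := by
    have h1 : f * (g + 1) = s * (g + f^2) := by
      have h2 : s * (g / (g+1) + 1 / (g+1) * f^2) = s * (g + f^2) / (g+1) := by ring
      exact (eq_div_iff (by positivity)).1 (hf.trans h2)
    rw [hfy] at h1
    have h2 : g * (y₀ * (g + 1)) = g * (s * (1 + g * y₀^2)) := by linarith
    have h3 := mul_left_cancel₀ hg0.ne' h2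
    linarith
  have hy₀s : y₀ < s := by
    have : 0 < g * y₀ * (1 - s * y₀) := by positivity
    linarith
  set p : ℝ := y₀ * (1 - s^2) / ((s - y₀) * (1 - s * y₀)) with hp
  have hp0 : 0 < p := by
    have : 0 < s - y₀ := by linarith
    have : 0 < 1 - s^2 := by nlinarith
    positivity
  set K : ℝ := g * y₀ ^ (p+1) with hKdef
  have hK0 : 0 < K := by positivity
  have hE : K⁻¹ * (y₀ ^ p * (s - y₀)) = 1 - s * y₀ := by
    rw [hroot, hKdef, Real.rpow_add_one hy₀.ne']
    have : 0 < y₀ ^ p := Real.rpow_pos_of_pos hy₀ p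
    field_simp
  have hE0 : 0 ≤ K⁻¹ := by positivity
  set η := green G μ z (ENNReal.ofReal s) with hη
  set e : V → ℝ≥0∞ := fun x => ENNReal.ofReal K⁻¹ ^ G.level o n x with he
  have hC := tsum_boundary_green_rpow_le (e := e) (K := (1 + ENNReal.ofReal K⁻¹) ^ n) hμ ho hS hp0
    (fun x => (pow_le_pow_left' le_add_self _).trans
      (pow_le_pow_right₀ le_self_add (WeightedGraph.level_le x)))
    (ENNReal.pow_ne_top (by simp)) (by simp [he, WeightedGraph.level_self])
    (fun x y hxy a b ha hb => ennreal_edge hs0 hs1 hy₀ hy₀s hp hE hp0 hE0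
      (WeightedGraph.level_le_add_one (by rwa [G.symm])) (WeightedGraph.level_le_add_one hxy) ha hb)
  have hC' : ∑' x, (∑' y : z, G.w x y) * η x ^ (p+1)
      ≤ ENNReal.ofReal K ^ n * resistance G o z μ ^ p := by
    have h1 (x : V) : (∑' y : z, G.w x y) * η x ^ (p+1) =
        ENNReal.ofReal K ^ n * ((∑' y : z, G.w x y) * (e x * η x ^ (p+1))) := by
      by_cases hx : ∀ y : z, G.w x y = 0
      · simp [hx]
      · push Not at hx
        obtain ⟨y, hy⟩ := hx
        have hl := WeightedGraph.level_eq_of_distGE hdist y.2 (pos_iff_ne_zero.2 hy)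
        have hKK : ENNReal.ofReal K ^ n * ENNReal.ofReal K⁻¹ ^ n = 1 := by
          rw [← mul_pow, ← ENNReal.ofReal_mul hK0.le, mul_inv_cancel₀ hK0.ne', ENNReal.ofReal_one,
            one_pow]
        simp only [he, hl]
        calc _ = (ENNReal.ofReal K ^ n * ENNReal.ofReal K⁻¹ ^ n) *
              ((∑' y : z, G.w x y) * η x ^ (p+1)) := by rw [hKK, one_mul]
          _ = _ := by ring
    simp only [h1]
    rw [ENNReal.tsum_mul_left]
    exact mul_le_mul_right (hC.trans
      (ENNReal.rpow_le_rpow (green_le_resistance hS.le) hp0.le)) _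
  refine (tsum_mul_le_holder _ η hp0).trans ?_
  rw [WeightedGraph.tsum_boundary]
  refine (mul_le_mul_right (ENNReal.rpow_le_rpow hC' (by positivity)) _).trans (le_of_eq ?_)
  have hq : 0 ≤ 1 / (p+1) := by positivity
  have hb : 0 ≤ p / (p+1) := by positivity
  have hreal : g ^ (p / (p+1)) * K ^ (1 / (p+1)) = f := by
    rw [hKdef, Real.mul_rpow hg0.le (by positivity), ← Real.rpow_mul hy₀.le, ← mul_assoc,
      ← Real.rpow_add hg0, show p / (p+1) + 1 / (p+1) = 1 by field_simp,
      show (p+1) * (1 / (p+1)) = 1 by field_simp, Real.rpow_one, Real.rpow_one, hfy]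
  have hswap (x : ℝ≥0∞) (r : ℝ) : (x ^ n) ^ r = (x ^ r) ^ n := by
    rw [← ENNReal.rpow_natCast, ← ENNReal.rpow_natCast, ← ENNReal.rpow_mul, ← ENNReal.rpow_mul,
      mul_comm]
  rw [ENNReal.mul_rpow_of_nonneg _ _ hq, ← ENNReal.rpow_mul, mul_one_div, mul_left_comm,
    ← ENNReal.mul_rpow_of_nonneg _ _ hb, hgn, hswap, hswap, ← mul_pow,
    ENNReal.ofReal_rpow_of_nonneg hg0.le hb, ENNReal.ofReal_rpow_of_nonneg hK0.le hq,
    ← ENNReal.ofReal_mul (by positivity), mul_comm, hreal]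


lemma continuous_expNeg (t : ℝ≥0∞) : Continuous fun lam => expNeg lam t := by
  unfold expNeg
  split_ifs
  · exact continuous_const
  · exact ENNReal.continuous_ofReal.comp (by fun_prop)

lemma expNeg_le_expNeg_zero {lam : ℝ} (hlam : 0 ≤ lam) (t : ℝ≥0∞) :
    expNeg lam t ≤ expNeg 0 t := by
  unfold expNeg
  split_ifs
  · exact le_rfl
  · refine ENNReal.ofReal_le_ofReal (Real.exp_le_exp.2 ?_)
    have : 0 ≤ lam * t.toReal := mul_nonneg hlam ENNReal.toReal_nonneg
    linarith

/-- Laplace transform domination, resistance form: with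
`g = (w_z r_{oz})^{1/n} > 1`, for every `λ ≥ 0` one has
`E[e^{-λ (T'_{0n}+1)}] ≥ E[e^{-λ T_{oz}}]`. -/
theorem laplace_domination_resistance
    {V : Type*} [Countable V] [MeasurableSpace V] [MeasurableSingletonClass V]
    (G : WeightedGraph V) (o : V) (z : Set V) (n : ℕ) (hn : 1 ≤ n) (g : ℝ)
    (μ : Measure (ℕ → V)) (hμ : IsRandomWalk G o μ)
    (ν : Measure (ℕ → ℤ)) (hν : IsBiasedWalk g ν)
    (hdist : G.distGE o z (n + 1))
    (hgdef : ENNReal.ofReal g = (G.setWeight z * resistance G o z μ) ^ ((n : ℝ)⁻¹))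
    (hg : 1 < g)
    (lam : ℝ) (hlam : 0 ≤ lam) :
    ∫⁻ ω, expNeg lam (hitTime z ω) ∂μ
      ≤ ∫⁻ ω, expNeg lam (hitTime {m : ℤ | m = (n : ℤ)} ω + 1) ∂ν := by
  have hμ' : IsMarkovLaw G.trans o μ := by
    refine ⟨hμ.1, fun k x => ?_⟩
    convert hμ.2 k x
  have hν' : IsMarkovLaw (biasedStep g) 0 ν := by
    refine ⟨hν.1, fun k x => ?_⟩
    convert hν.2 k x
  have hgn : G.setWeight z * resistance G o z μ = ENNReal.ofReal g ^ n := by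
    rw [hgdef, ← ENNReal.rpow_natCast, ← ENNReal.rpow_mul,
      inv_mul_cancel₀ (by positivity), ENNReal.rpow_one]
  have ho : o ∉ z := fun h => absurd (hdist 0 (fun _ => o) rfl (by simp) h) (by omega)
  have hpos {lam : ℝ} (hlam : 0 < lam) : ∫⁻ ω, expNeg lam (hitTime z ω) ∂μ
      ≤ ∫⁻ ω, expNeg lam (hitTime {m : ℤ | m = (n : ℤ)} ω + 1) ∂ν := by
    obtain ⟨f, hf0, hf1, hf⟩ := exists_root hg (Real.exp_pos (-lam))
      (Real.exp_lt_one_iff.2 (by linarith))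
    refine (lintegral_expNeg_hitTime_le hμ' hdist hgn hg hlam hf0 hf1 hf).trans ?_
    simp only [expNeg_add_one]
    rw [lintegral_const_mul' _ _ ENNReal.ofReal_ne_top]
    exact mul_le_mul_right
      (pow_le_lintegral_biased hν' hn (by linarith) hlam hf0.le hf1.le hf) _
  rcases hlam.eq_or_lt with rfl | hlam
  · have hlim : Tendsto (fun j : ℕ => 1 / ((j : ℝ) + 1)) atTop (nhds 0) :=
      tendsto_one_div_add_atTop_nhds_zero_nat
    have hfatou := lintegral_liminf_le (μ := μ) (u := atTop)
      (f := fun (j : ℕ) ω => expNeg (1 / ((j : ℝ) + 1)) (hitTime z ω))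
      fun j => measurable_expNeg_hitTime _ z
    have hptw (ω : ℕ → V) : liminf (fun j : ℕ => expNeg (1 / ((j : ℝ) + 1)) (hitTime z ω)) atTop
        = expNeg 0 (hitTime z ω) :=
      ((continuous_expNeg _).tendsto 0 |>.comp hlim).liminf_eq
    simp only [hptw] at hfatou
    refine hfatou.trans ?_
    refine liminf_le_of_le (by isBoundedDefault) fun b hb => ?_
    obtain ⟨j, hj⟩ := hb.exists
    have hj0 : (0 : ℝ) < 1 / ((j : ℝ) + 1) := by positivity
    exact hj.trans ((hpos hj0).trans (lintegral_mono fun ω => expNeg_le_expNeg_zero hj0.le _))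
  · exact hpos hlam

end RWHitting
end

section
/- Let C > 0, g > 1 and 1 < a₀ < (g+1)/(g−1). There exist constants C₁, C₂ > 0 (depending only on C, g, a₀) such that for every integer n ≥ 1, every weighted graph G with a vertex o and a vertex set z satisfying dist(o,z) ≥ n and w_z/w_o ≤ C g^n, and every a ∈ [a₀, (g+1)/(g−1)]: E[T_{oz}] > n(g+1)/(g−1) − C₂ and P[T_{oz} ≤ an] < C₁ e^{−I_g(a) n}. -/
open MeasureTheory Filter
open scoped Classical ENNReal

namespace RWHitting

variable {V : Type*}

/-- The large deviation rate function `I_g(a)`, given by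
`e^{-I_g(a)} = (g/(a+1)) (g/(a²-1))^((a-1)/2) (2a/(g+1))^a` for `a < (g+1)/(g-1)`,
extended by `I_g((g+1)/(g-1)) := 0`. -/
noncomputable def IgBar (g a : ℝ) : ℝ :=
  if a = (g + 1) / (g - 1) then 0
  else -Real.log (g / (a + 1) * (g / (a ^ 2 - 1)) ^ ((a - 1) / 2) * (2 * a / (g + 1)) ^ a)

/-- A discrete conservation law: if mass injected by `σ` is carried by a flow between `D` and `U`
that strictly decreases the rank `ρ`, then all of it ends up in `z`. -/
theorem tsum_source_le_of_flow {V : Type*} (z : Set V) (U D : V → V → ℝ≥0∞) (σ : V → ℝ≥0∞)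
    (Z : ℝ≥0∞) (ρ : V → ℕ)
    (hUD : ∀ x, x ∉ z → ∀ y, U x y ≤ D x y)
    (hρ : ∀ x y, D x y ≠ 0 → ρ y < ρ x)
    (hbal : ∀ x, x ∉ z → σ x + ∑' u, D u x ≤ ∑' y, U x y)
    (hz : ∑' y, z.indicator (fun y => σ y + ∑' u, D u y) y ≤ Z) :
    ∑' y, σ y ≤ Z := by
  by_cases hZ : Z = ⊤
  · simp [hZ]
  set m : V → ℝ≥0∞ := fun y => σ y + ∑' u, D u y with hm
  set S : ℕ → Set V := fun j => {x | x ∉ z ∧ ρ x < j} with hS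
  set M : ℕ → ℝ≥0∞ := fun j => ∑' x, (S j).indicator m x with hM
  have step : ∀ j, M (j + 1) + ∑' y, (S j ∪ z).indicator σ y ≤ M j + Z := by
    intro j
    have h1 : M (j + 1) ≤ ∑' y, (S j ∪ z).indicator (fun y => ∑' x, D x y) y := by
      calc M (j + 1) ≤ ∑' x, (S (j + 1)).indicator (fun x => ∑' y, D x y) x := by
            refine ENNReal.tsum_le_tsum fun x => ?_
            by_cases hx : x ∈ S (j + 1)
            · rw [Set.indicator_of_mem hx, Set.indicator_of_mem hx]
              exact (hbal x hx.1).trans (ENNReal.tsum_le_tsum (hUD x hx.1))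
            · simp [hx]
        _ ≤ ∑' x, ∑' y, (S j ∪ z).indicator (fun y => D x y) y := by
            refine ENNReal.tsum_le_tsum fun x => ?_
            by_cases hx : x ∈ S (j + 1)
            · rw [Set.indicator_of_mem hx]
              refine ENNReal.tsum_le_tsum fun y => ?_
              by_cases hy : D x y = 0
              · simp [hy]
              · have h2 := hρ x y hy
                have h3 : ρ x < j + 1 := hx.2
                rw [Set.indicator_of_mem]
                by_cases hyz : y ∈ z
                · exact Or.inr hyz
                · exact Or.inl ⟨hyz, by omega⟩
            · simp [hx]
        _ = ∑' y, (S j ∪ z).indicator (fun y => ∑' x, D x y) y := by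
            rw [ENNReal.tsum_comm]
            refine tsum_congr fun y => ?_
            by_cases hy : y ∈ S j ∪ z
            · simp only [Set.indicator_of_mem hy]
            · simp only [Set.indicator_of_notMem hy, tsum_zero]
    calc M (j + 1) + ∑' y, (S j ∪ z).indicator σ y
        ≤ ∑' y, (S j ∪ z).indicator (fun y => ∑' x, D x y) y
            + ∑' y, (S j ∪ z).indicator σ y := by gcongr
      _ = ∑' y, (S j ∪ z).indicator m y := by
          rw [← ENNReal.tsum_add]
          refine tsum_congr fun y => ?_
          by_cases hy : y ∈ S j ∪ z
          · simp only [Set.indicator_of_mem hy, hm, add_comm]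
          · simp only [Set.indicator_of_notMem hy, add_zero]
      _ ≤ ∑' y, ((S j).indicator m y + z.indicator m y) := by
          refine ENNReal.tsum_le_tsum fun y => ?_
          by_cases hy : y ∈ z
          · rw [Set.indicator_of_mem (Set.mem_union_right _ hy), Set.indicator_of_mem hy]
            exact le_add_self
          · by_cases hy' : y ∈ S j
            · rw [Set.indicator_of_mem (Set.mem_union_left _ hy'), Set.indicator_of_mem hy']
              exact le_self_add
            · have : y ∉ S j ∪ z := fun h => h.elim hy' hy
              simp [Set.indicator_of_notMem this]
      _ = M j + ∑' y, z.indicator m y := ENNReal.tsum_add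
      _ ≤ M j + Z := by gcongr
  have fin : ∀ j, M j ≠ ⊤ := by
    intro j
    induction j with
    | zero => simp [hM, hS]
    | succ j ih =>
      exact ne_top_of_le_ne_top (ENNReal.add_ne_top.2 ⟨ih, hZ⟩) (le_self_add.trans (step j))
  have key : ∀ j, ∑' y, (S j ∪ z).indicator σ y ≤ Z := by
    intro j
    have hmono : M j ≤ M (j + 1) := by
      refine ENNReal.tsum_le_tsum fun x => ?_
      refine Set.indicator_le_indicator_of_subset ?_ (fun _ => zero_le) x
      exact fun x hx => ⟨hx.1, hx.2.trans (Nat.lt_succ_self j)⟩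
    exact (ENNReal.add_le_add_iff_left (fin j)).1 ((add_le_add_left hmono _).trans (step j))
  rw [ENNReal.tsum_eq_iSup_sum]
  refine iSup_le fun s => ?_
  refine le_trans ?_ (key (s.sup ρ + 1))
  refine le_trans (Finset.sum_le_sum fun x hx => ?_) (ENNReal.sum_le_tsum s)
  rw [Set.indicator_of_mem]
  by_cases hxz : x ∈ z
  · exact Or.inr hxz
  · exact Or.inl ⟨hxz, Nat.lt_succ_of_le (Finset.le_sup hx)⟩

/-- If two functions have the same finite weighted sum, then so do the positive and negative parts
of their difference. -/
theorem tsum_mul_tsub_eq {V : Type*} (w a b : V → ℝ≥0∞)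
    (h : ∑' y, w y * a y = ∑' y, w y * b y) (hfin : ∑' y, w y * a y ≠ ⊤) :
    ∑' y, w y * (a y - b y) = ∑' y, w y * (b y - a y) := by
  have h1 : ∑' y, w y * b y + ∑' y, w y * (a y - b y)
      = ∑' y, w y * a y + ∑' y, w y * (b y - a y) := by
    rw [← ENNReal.tsum_add, ← ENNReal.tsum_add]
    refine tsum_congr fun y => ?_
    rw [← mul_add, ← mul_add, add_tsub_eq_max, add_tsub_eq_max, max_comm]
  rw [← h] at h1
  exact (ENNReal.add_right_inj hfin).1 h1

theorem mul_tsum_le_mul_tsub {V : Type*} (w a b : V → ℝ≥0∞) :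
    ∑' y, w y * a y ≤ ∑' y, w y * (a y - b y) + ∑' y, w y * b y := by
  rw [← ENNReal.tsum_add]
  refine ENNReal.tsum_le_tsum fun y => ?_
  rw [← mul_add]
  gcongr
  exact le_tsub_add

/-- The graph distance from `o`, capped at `n`. -/
noncomputable def cappedDist {V : Type*} (G : WeightedGraph V) (o : V) (n : ℕ) (x : V) : ℕ :=
  sInf {k | k = n ∨ ∃ p : ℕ → V, p 0 = o ∧ (∀ i, i < k → 0 < G.w (p i) (p (i + 1))) ∧ p k = x}

theorem cappedDist_mem {V : Type*} (G : WeightedGraph V) (o : V) (n : ℕ) (x : V) :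
    cappedDist G o n x = n ∨ ∃ p : ℕ → V, p 0 = o ∧
      (∀ i, i < cappedDist G o n x → 0 < G.w (p i) (p (i + 1))) ∧ p (cappedDist G o n x) = x :=
  Nat.sInf_mem (s := {k | k = n ∨ ∃ p : ℕ → V, p 0 = o ∧
    (∀ i, i < k → 0 < G.w (p i) (p (i + 1))) ∧ p k = x}) ⟨n, Or.inl rfl⟩

theorem cappedDist_le {V : Type*} (G : WeightedGraph V) (o : V) (n : ℕ) (x : V) :
    cappedDist G o n x ≤ n :=
  Nat.sInf_le (Or.inl rfl)

theorem cappedDist_self {V : Type*} (G : WeightedGraph V) (o : V) (n : ℕ) :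
    cappedDist G o n o = 0 :=
  Nat.le_zero.1 <| Nat.sInf_le (Or.inr ⟨fun _ => o, rfl, by simp, rfl⟩)

theorem cappedDist_le_succ {V : Type*} (G : WeightedGraph V) (o : V) (n : ℕ) {x y : V}
    (h : G.w x y ≠ 0) : cappedDist G o n y ≤ cappedDist G o n x + 1 := by
  rcases cappedDist_mem G o n x with hx | ⟨p, h0, hp, hx⟩
  · have := cappedDist_le G o n y
    omega
  · set k := cappedDist G o n x
    refine Nat.sInf_le (Or.inr ⟨fun i => if i ≤ k then p i else y, by simp [h0], ?_, by simp⟩)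
    intro i hi
    rcases Nat.lt_or_ge i k with hik | hik
    · simpa [hik.le, Nat.succ_le_of_lt hik] using hp i hik
    · have : i = k := by omega
      subst this
      simpa [hx] using pos_iff_ne_zero.2 h

theorem cappedDist_of_distGE {V : Type*} (G : WeightedGraph V) {o : V} {z : Set V} {n : ℕ}
    (h : G.distGE o z n) {x : V} (hx : x ∈ z) : cappedDist G o n x = n := by
  rcases cappedDist_mem G o n x with h1 | ⟨p, h0, hp, hk⟩
  · exact h1
  · exact le_antisymm (cappedDist_le G o n x) (h _ p h0 hp (by rw [hk]; exact hx))


/-- Comparison of the outgoing weight at `o` with the weight of `z`, given a flow on the edges of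
`G` inside `R` which loses at least a factor `β` in every step. -/
theorem weight_le_of_flow {V : Type*} (G : WeightedGraph V) {o : V} {z : Set V} {n : ℕ}
    (hd : G.distGE o z n) (R : Set V) (θ u₀ : V → ℝ≥0∞) (u δ : V → V → ℝ≥0∞)
    (β c : ℝ≥0∞) (ρ : V → ℕ) (hβ : β ≤ 1) (hoR : o ∉ R)
    (hu₀R : ∀ y, u₀ y ≠ 0 → y ∈ R) (huR : ∀ x ∈ R, ∀ y, u x y ≠ 0 → y ∈ R)
    (hρ : ∀ x ∈ R, ∀ y, u x y ≠ 0 → ρ y < ρ x)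
    (hu : ∀ x ∈ R, x ∉ z → ∀ y, y ∉ z → G.w x y ≠ 0 → u x y * θ x ≤ β * (δ x y * θ y))
    (huz : ∀ x ∈ R, x ∉ z → ∀ y ∈ z, G.w x y ≠ 0 → u x y * θ x ≤ β * c)
    (hu₀ : ∀ y, y ∉ z → u₀ y * θ o ≤ δ o y * θ y)
    (hu₀z : ∀ y ∈ z, u₀ y * θ o ≤ c)
    (hbal : ∀ x ∈ R, x ∉ z → ∑' y, G.w x y * δ y x ≤ ∑' y, G.w x y * u x y) :
    (∑' y, G.w o y * u₀ y) * θ o * β ≤ c * β ^ n * G.setWeight z := by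
  set d := cappedDist G o n with hddef
  have hdo : d o = 0 := cappedDist_self G o n
  have hds : ∀ x y, G.w x y ≠ 0 → β ^ d x * β ≤ β ^ d y := fun x y h => by
    rw [← pow_succ]
    exact pow_le_pow_of_le_one zero_le hβ (cappedDist_le_succ G o n h)
  set τ : V → V → ℝ≥0∞ := fun x y => if y ∈ z then c else δ x y * θ y with hτ
  have huτ : ∀ x ∈ R, x ∉ z → ∀ y, G.w x y ≠ 0 → u x y * θ x ≤ β * τ x y := by
    intro x hx hxz y hw
    by_cases hy : y ∈ z
    · simpa [hτ, hy] using huz x hx hxz y hy hw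
    · simpa [hτ, hy] using hu x hx hxz y hy hw
  have hu₀τ : ∀ y, u₀ y * θ o ≤ τ o y := by
    intro y
    by_cases hy : y ∈ z
    · simpa [hτ, hy] using hu₀z y hy
    · simpa [hτ, hy] using hu₀ y hy
  set E : V → V → Prop := fun x y => x ∈ R ∧ x ∉ z ∧ u x y ≠ 0 with hE
  set U : V → V → ℝ≥0∞ := fun x y =>
    if E x y then G.w x y * (u x y * θ x * β ^ d x) else 0 with hU
  set D : V → V → ℝ≥0∞ := fun x y =>
    if E x y then G.w x y * (τ x y * β ^ d y) else 0 with hD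
  set σ : V → ℝ≥0∞ := fun y => G.w o y * (u₀ y * θ o * β) with hσ
  have hin : ∀ y ∈ R, σ y + ∑' x, D x y ≤ ∑' x, G.w y x * (τ x y * β ^ d y) := by
    intro y hy
    have h1 : σ y ≤ G.w y o * (τ o y * β ^ d y) := by
      by_cases hw : G.w o y = 0
      · simp [hσ, hw]
      · rw [G.symm y o]
        have h2 := hds o y hw
        rw [hdo, pow_zero, one_mul] at h2
        exact mul_le_mul_right (mul_le_mul' (hu₀τ y) h2) _
    have h3 : σ y = ∑' x, if x = o then σ y else 0 := by simp
    rw [h3, ← ENNReal.tsum_add]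
    refine ENNReal.tsum_le_tsum fun x => ?_
    by_cases hx : x = o
    · subst hx
      have : ¬ E x y := fun h => hoR h.1
      simpa [hD, this] using h1
    · simp only [hx, if_false, zero_add, hD]
      split_ifs
      · rw [G.symm y x]
      · exact zero_le
  have hzero : ∀ y, y ∉ R → σ y + ∑' x, D x y = 0 := by
    intro y hy
    have h1 : u₀ y = 0 := by
      by_contra h
      exact hy (hu₀R y h)
    have h2 : ∀ x, D x y = 0 := fun x => by
      have : ¬ E x y := fun h => hy (huR x h.1 y h.2.2)
      simp [hD, this]
    simp [h2, hσ, h1]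
  have main : ∑' y, σ y ≤ c * β ^ n * G.setWeight z := by
    refine tsum_source_le_of_flow z U D σ _ ρ ?_ ?_ ?_ ?_
    · intro x _ y
      simp only [hU, hD]
      split_ifs with h
      · by_cases hw : G.w x y = 0
        · simp [hw]
        · refine mul_le_mul_right ?_ _
          calc u x y * θ x * β ^ d x ≤ β * τ x y * β ^ d x := by
                exact mul_le_mul_left (huτ x h.1 h.2.1 y hw) _
            _ = τ x y * (β ^ d x * β) := by ring
            _ ≤ τ x y * β ^ d y := by
                gcongr
                exact hds x y hw
      · exact le_rfl
    · intro x y hxy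
      have h : E x y := by
        by_contra h
        exact hxy (by simp [hD, h])
      exact hρ x h.1 y h.2.2
    · intro y hyz
      by_cases hy : y ∈ R
      · refine (hin y hy).trans ?_
        calc ∑' x, G.w y x * (τ x y * β ^ d y) = (∑' x, G.w y x * δ x y) * (θ y * β ^ d y) := by
              rw [← ENNReal.tsum_mul_right]
              refine tsum_congr fun x => ?_
              simp only [hτ, hyz, if_false]
              ring
          _ ≤ (∑' x, G.w y x * u y x) * (θ y * β ^ d y) := by
              exact mul_le_mul_left (hbal y hy hyz) _
          _ = ∑' x, U y x := by
              rw [← ENNReal.tsum_mul_right]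
              refine tsum_congr fun x => ?_
              by_cases hux : u y x = 0
              · simp [hU, hux]
              · have : E y x := ⟨hy, hyz, hux⟩
                simp only [hU, this, if_true]
                ring
      · simp [hzero y hy]
    · have hset : G.setWeight z = ∑' y, z.indicator G.vw y := tsum_subtype z G.vw
      rw [hset, ← ENNReal.tsum_mul_left]
      refine ENNReal.tsum_le_tsum fun y => ?_
      by_cases hyz : y ∈ z
      · rw [Set.indicator_of_mem hyz, Set.indicator_of_mem hyz]
        by_cases hy : y ∈ R
        · refine (hin y hy).trans (le_of_eq ?_)
          rw [WeightedGraph.vw, ← ENNReal.tsum_mul_left]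
          refine tsum_congr fun x => ?_
          have : d y = n := cappedDist_of_distGE G hd hyz
          simp only [hτ, hyz, if_true, this]
          ring
        · simp [hzero y hy]
      · simp [hyz]
  refine le_trans (le_of_eq ?_) main
  rw [mul_assoc, ← ENNReal.tsum_mul_right]
  exact tsum_congr fun y => by simp only [hσ]; ring


theorem tsum_trans {V : Type*} (G : WeightedGraph V) (x : V) : ∑' y, G.trans x y = 1 := by
  simp only [WeightedGraph.trans, div_eq_mul_inv, ENNReal.tsum_mul_right]
  exact ENNReal.mul_inv_cancel (G.vw_pos x).ne' (G.vw_lt_top x).ne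

theorem vw_mul_trans {V : Type*} (G : WeightedGraph V) (x y : V) :
    G.vw x * G.trans x y = G.w x y :=
  ENNReal.mul_div_cancel (G.vw_pos x).ne' (G.vw_lt_top x).ne

/-- The probability that the walk started at `x` first visits `z` at time `k`. -/
noncomputable def firstHit {V : Type*} (G : WeightedGraph V) (z : Set V) : ℕ → V → ℝ≥0∞
  | 0, x => if x ∈ z then 1 else 0
  | k + 1, x => if x ∈ z then 0 else ∑' y, G.trans x y * firstHit G z k y

/-- The probability that the walk started at `x` does not visit `z` up to time `k`. -/
noncomputable def survival {V : Type*} (G : WeightedGraph V) (z : Set V) : ℕ → V → ℝ≥0∞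
  | 0, x => if x ∈ z then 0 else 1
  | k + 1, x => if x ∈ z then 0 else ∑' y, G.trans x y * survival G z k y

theorem survival_add_sum_firstHit {V : Type*} (G : WeightedGraph V) (z : Set V) (k : ℕ) (x : V) :
    survival G z k x + ∑ j ∈ Finset.range (k + 1), firstHit G z j x = 1 := by
  induction k generalizing x with
  | zero => by_cases hx : x ∈ z <;> simp [survival, firstHit, hx]
  | succ k ih =>
    rw [Finset.sum_range_succ']
    by_cases hx : x ∈ z
    · simp [survival, firstHit, hx]
    · simp only [survival, firstHit, hx, if_false, add_zero]
      rw [← Summable.tsum_finsetSum (fun _ _ => ENNReal.summable), ← ENNReal.tsum_add]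
      rw [← tsum_trans G x]
      refine tsum_congr fun y => ?_
      rw [← Finset.mul_sum, ← mul_add, ih y, mul_one]

theorem tsum_path_eq_firstHit {V : Type*} (G : WeightedGraph V) (z : Set V) (k : ℕ) (o : V) :
    ∑' x : Fin (k + 1) → V,
      (if x 0 = o ∧ (∀ i : Fin k, x i.castSucc ∉ z) ∧ x (Fin.last k) ∈ z then
        ∏ i : Fin k, G.trans (x i.castSucc) (x i.succ) else 0) = firstHit G z k o := by
  induction k generalizing o with
  | zero =>
    rw [← (Equiv.funUnique (Fin 1) V).symm.tsum_eq]
    rw [tsum_eq_single o]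
    · simp [firstHit]
    · intro y hy
      simp [hy]
  | succ k ih =>
    rw [← (Fin.consEquiv (fun _ : Fin (k + 2) => V)).tsum_eq, ENNReal.tsum_prod']
    have hc : ∀ (a : V) (x : Fin (k + 1) → V),
        (Fin.consEquiv (fun _ : Fin (k + 2) => V)) (a, x) = Fin.cons a x := fun _ _ => rfl
    simp only [hc]
    rw [tsum_eq_single o]
    swap
    · intro a ha
      simp [ha]
    by_cases ho : o ∈ z
    · simp only [firstHit, ho, if_true]
      refine ENNReal.tsum_eq_zero.2 fun x => if_neg fun h => ?_
      exact h.2.1 0 (by simpa using ho)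
    · simp only [firstHit, ho, if_false]
      have : ∀ y, G.trans o y * firstHit G z k y = ∑' x : Fin (k + 1) → V,
          (if x 0 = y then (if (∀ i : Fin k, x i.castSucc ∉ z) ∧ x (Fin.last k) ∈ z then
            G.trans o (x 0) * ∏ i : Fin k, G.trans (x i.castSucc) (x i.succ) else 0) else 0) := by
        intro y
        rw [← ih y, ← ENNReal.tsum_mul_left]
        refine tsum_congr fun x => ?_
        by_cases hxy : x 0 = y
        · simp [hxy, mul_ite]
        · simp [hxy]
      simp only [this]
      rw [ENNReal.tsum_comm]
      refine tsum_congr fun x => ?_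
      rw [tsum_eq_single (x 0) (fun y hy => if_neg (Ne.symm hy)), if_pos rfl]
      rw [Fin.prod_univ_succ, ← Fin.succ_last]
      simp only [Fin.forall_fin_succ, ← Fin.succ_castSucc, Fin.cons_succ, Fin.cons_zero, Fin.castSucc_zero]
      simp [ho]

theorem measure_firstHit_le {V : Type*} [Countable V] [MeasurableSpace V] (G : WeightedGraph V)
    {o : V} (z : Set V) {μ : Measure (ℕ → V)} (hμ : IsRandomWalk G o μ) (k : ℕ) :
    μ {ω | ω k ∈ z ∧ ∀ i < k, ω i ∉ z} ≤ firstHit G z k o := by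
  rw [← tsum_path_eq_firstHit]
  have hsub : {ω : ℕ → V | ω k ∈ z ∧ ∀ i < k, ω i ∉ z} ⊆ ⋃ x : Fin (k + 1) → V,
      {ω | (∀ i : Fin (k + 1), ω i = x i) ∧
        (∀ i : Fin k, x i.castSucc ∉ z) ∧ x (Fin.last k) ∈ z} := by
    rintro ω ⟨hk, hi⟩
    exact Set.mem_iUnion.2 ⟨fun i => ω i, fun i => rfl, fun i => hi _ i.2, hk⟩
  refine (measure_mono hsub).trans ((measure_iUnion_le _).trans ?_)
  refine ENNReal.tsum_le_tsum fun x => ?_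
  by_cases h : (∀ i : Fin k, x i.castSucc ∉ z) ∧ x (Fin.last k) ∈ z
  · have h1 := hμ.2 k x
    simp only [and_iff_left h]
    rw [h1]
    by_cases h0 : x 0 = o <;> simp [h0]
  · simp [h]

theorem hitTime_eq_of_first {V : Type*} {z : Set V} {ω : ℕ → V} {k : ℕ} (hk : ω k ∈ z)
    (hi : ∀ i < k, ω i ∉ z) : hitTime z ω = k := by
  refine le_antisymm (iInf₂_le k hk) (le_iInf₂ fun j hj => ?_)
  exact_mod_cast not_lt.1 fun h => hi j h hj

theorem exists_first {V : Type*} {z : Set V} {ω : ℕ → V} (h : ∃ k, ω k ∈ z) :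
    ∃ k, ω k ∈ z ∧ ∀ i < k, ω i ∉ z :=
  ⟨Nat.find h, Nat.find_spec h, fun _ hi => Nat.find_min h hi⟩

theorem measure_hitTime_le {V : Type*} [Countable V] [MeasurableSpace V] (G : WeightedGraph V)
    {o : V} (z : Set V) {μ : Measure (ℕ → V)} (hμ : IsRandomWalk G o μ) {t : ℝ} (ht : 0 ≤ t) :
    μ {ω | hitTime z ω ≤ ENNReal.ofReal t}
      ≤ ∑ j ∈ Finset.range (⌊t⌋₊ + 1), firstHit G z j o := by
  have hsub : {ω | hitTime z ω ≤ ENNReal.ofReal t} ⊆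
      ⋃ j ∈ Finset.range (⌊t⌋₊ + 1), {ω | ω j ∈ z ∧ ∀ i < j, ω i ∉ z} := by
    intro ω hω
    have hex : ∃ k, ω k ∈ z := by
      by_contra! h
      have : hitTime z ω = ⊤ := by simp [hitTime, h]
      simp [this] at hω
    obtain ⟨k, hk, hi⟩ := exists_first hex
    have hkt : (k : ℝ≥0∞) ≤ ENNReal.ofReal t := by
      rw [← hitTime_eq_of_first hk hi]
      exact hω
    rw [← ENNReal.ofReal_natCast, ENNReal.ofReal_le_ofReal_iff ht] at hkt
    simp only [Set.mem_iUnion]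
    exact ⟨k, Finset.mem_range.2 (Nat.lt_succ_of_le (Nat.le_floor hkt)), hk, hi⟩
  refine (measure_mono hsub).trans ((measure_biUnion_finset_le _ _).trans ?_)
  exact Finset.sum_le_sum fun j _ => measure_firstHit_le G z hμ j

theorem tsum_survival_le_expHit {V : Type*} [Countable V] [MeasurableSpace V]
    [MeasurableSingletonClass V] (G : WeightedGraph V)
    {o : V} (z : Set V) {μ : Measure (ℕ → V)} (hμ : IsRandomWalk G o μ) :
    ∑' k, survival G z k o ≤ expHit μ z := by
  have := hμ.1
  have hmeas : ∀ k : ℕ, MeasurableSet {ω : ℕ → V | ∀ i ≤ k, ω i ∉ z} := by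
    intro k
    have : {ω : ℕ → V | ∀ i ≤ k, ω i ∉ z} = ⋂ i, ⋂ _ : i ≤ k, (fun ω : ℕ → V => ω i) ⁻¹' zᶜ := by
      ext ω
      simp
    rw [this]
    exact MeasurableSet.iInter fun i => MeasurableSet.iInter fun _ =>
      measurable_pi_apply i (Set.to_countable zᶜ).measurableSet
  have hs : ∀ k, survival G z k o ≤ μ {ω : ℕ → V | ∀ i ≤ k, ω i ∉ z} := by
    intro k
    have h1 := survival_add_sum_firstHit G z k o
    have hcompl : {ω : ℕ → V | ∀ i ≤ k, ω i ∉ z}ᶜ ⊆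
        ⋃ j ∈ Finset.range (k + 1), {ω | ω j ∈ z ∧ ∀ i < j, ω i ∉ z} := by
      intro ω hω
      simp only [Set.mem_compl_iff, Set.mem_ofPred_eq, not_forall, not_not] at hω
      obtain ⟨i, hik, hi⟩ := hω
      obtain ⟨j, hj, hj'⟩ := exists_first ⟨i, hi⟩
      have : j ≤ i := not_lt.1 fun h => hj' i h hi
      simp only [Set.mem_iUnion]
      exact ⟨j, Finset.mem_range.2 (by omega), hj, hj'⟩
    have h2 : μ {ω : ℕ → V | ∀ i ≤ k, ω i ∉ z}ᶜ ≤
        ∑ j ∈ Finset.range (k + 1), firstHit G z j o :=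
      (measure_mono hcompl).trans ((measure_biUnion_finset_le _ _).trans
        (Finset.sum_le_sum fun j _ => measure_firstHit_le G z hμ j))
    have h3 := prob_add_prob_compl (μ := μ) (hmeas k)
    have hfin : ∑ j ∈ Finset.range (k + 1), firstHit G z j o ≠ ⊤ :=
      ne_top_of_le_ne_top ENNReal.one_ne_top (h1 ▸ le_add_self)
    rw [← ENNReal.add_le_add_iff_right hfin, h1, ← h3]
    gcongr
  calc ∑' k, survival G z k o ≤ ∑' k, μ {ω : ℕ → V | ∀ i ≤ k, ω i ∉ z} :=
        ENNReal.tsum_le_tsum hs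
    _ = ∑' k, ∫⁻ ω, {ω : ℕ → V | ∀ i ≤ k, ω i ∉ z}.indicator 1 ω ∂μ := by
        simp only [lintegral_indicator_one (hmeas _)]
    _ = ∫⁻ ω, ∑' k, {ω : ℕ → V | ∀ i ≤ k, ω i ∉ z}.indicator 1 ω ∂μ := by
        rw [lintegral_tsum]
        exact fun k => ((measurable_one).indicator (hmeas k)).aemeasurable
    _ ≤ ∫⁻ ω, hitTime z ω ∂μ := by
        refine lintegral_mono fun ω => le_iInf₂ fun k hk => ?_
        calc ∑' j, {ω : ℕ → V | ∀ i ≤ j, ω i ∉ z}.indicator (1 : (ℕ → V) → ℝ≥0∞) ω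
            = ∑ j ∈ Finset.range k,
                {ω : ℕ → V | ∀ i ≤ j, ω i ∉ z}.indicator (1 : (ℕ → V) → ℝ≥0∞) ω := by
              refine tsum_eq_sum fun j hj => Set.indicator_of_notMem (fun h => ?_) _
              exact h k (by simpa using hj) hk
          _ ≤ ∑ j ∈ Finset.range k, 1 := by
              refine Finset.sum_le_sum fun j _ => Set.indicator_le_self' (by simp) _
          _ = k := by simp


/-- The generating function of the hitting time of `z`. -/
noncomputable def hitGen {V : Type*} (G : WeightedGraph V) (z : Set V) (s : ℝ) (x : V) : ℝ≥0∞ :=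
  ∑' k, ENNReal.ofReal (s ^ k) * firstHit G z k x

theorem hitGen_of_mem {V : Type*} (G : WeightedGraph V) {z : Set V} (s : ℝ) {x : V} (hx : x ∈ z) :
    hitGen G z s x = 1 := by
  rw [hitGen, tsum_eq_single 0]
  · simp [firstHit, hx]
  · intro k hk
    obtain ⟨j, rfl⟩ := Nat.exists_eq_succ_of_ne_zero hk
    simp [firstHit, hx]

theorem hitGen_le_one {V : Type*} (G : WeightedGraph V) (z : Set V) {s : ℝ} (hs : 0 ≤ s)
    (hs1 : s ≤ 1) (x : V) : hitGen G z s x ≤ 1 := by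
  rw [hitGen, ENNReal.tsum_eq_iSup_nat]
  refine iSup_le fun k => ?_
  calc ∑ j ∈ Finset.range k, ENNReal.ofReal (s ^ j) * firstHit G z j x
      ≤ ∑ j ∈ Finset.range k, firstHit G z j x := by
        refine Finset.sum_le_sum fun j _ => mul_le_of_le_one_left' ?_
        exact ENNReal.ofReal_le_one.2 (pow_le_one₀ hs hs1)
    _ ≤ ∑ j ∈ Finset.range (k + 1), firstHit G z j x :=
        Finset.sum_le_sum_of_subset (Finset.range_mono k.le_succ)
    _ ≤ 1 := (survival_add_sum_firstHit G z k x) ▸ le_add_self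

theorem tsum_mul_hitGen {V : Type*} (G : WeightedGraph V) {z : Set V} {s : ℝ} (hs : 0 < s)
    {x : V} (hx : x ∉ z) :
    ∑' y, G.w x y * hitGen G z s y = ∑' y, G.w x y * (ENNReal.ofReal (1 / s) * hitGen G z s x) := by
  have h1 : hitGen G z s x = ENNReal.ofReal s * ∑' y, G.trans x y * hitGen G z s y := by
    rw [hitGen, tsum_eq_zero_add' ENNReal.summable]
    simp only [firstHit, hx, if_false, mul_zero, zero_add]
    simp only [← ENNReal.tsum_mul_left, hitGen]
    rw [ENNReal.tsum_comm]
    refine tsum_congr fun y => tsum_congr fun k => ?_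
    rw [pow_succ, ENNReal.ofReal_mul (by positivity)]
    ring
  have h2 : ENNReal.ofReal (1 / s) * ENNReal.ofReal s = 1 := by
    rw [← ENNReal.ofReal_mul (by positivity), one_div_mul_cancel hs.ne', ENNReal.ofReal_one]
  conv_rhs => rw [h1]
  rw [← mul_assoc, h2, one_mul, ENNReal.tsum_mul_right, ← ENNReal.tsum_mul_left]
  refine tsum_congr fun y => ?_
  rw [← mul_assoc, show ∑' y, G.w x y = G.vw x from rfl, vw_mul_trans]

/-- The tangent line inequality for the one-step cost of the walk in exponential form. -/
theorem tangent_rpow {g x s κ : ℝ} (hg : 1 < g) (hx : 1 < x)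
    (hs : s = (g + 1) * x / (g * x ^ 2 + 1))
    (hκ : κ = (g + 1) * (g * x ^ 2 - 1) / (g * (x ^ 2 - 1))) (hκ1 : 1 ≤ κ) {r : ℝ}
    (hr : 1 / s < r) :
    g * x ^ κ * (r - 1 / s) ≤ (1 / s - 1 / r) * r ^ κ := by
  have hx0 : 0 < x := by linarith
  have hx2 : 0 < x ^ 2 - 1 := by nlinarith
  have hgx : 0 < g * x ^ 2 - 1 := by nlinarith
  have hs0 : 0 < s := by rw [hs]; positivity
  have hs1 : s < 1 := by
    rw [hs, div_lt_one (by positivity)]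
    nlinarith [mul_pos (sub_pos.2 hx) (show 0 < g * x - 1 by nlinarith)]
  have hr1 : 1 < r := lt_trans (by rw [lt_div_iff₀ hs0]; linarith) hr
  have hr0 : 0 < r := by linarith
  have hbern : 1 + κ * (r / x - 1) ≤ (r / x) ^ κ := by
    have := one_add_mul_self_le_rpow_one_add (s := r / x - 1)
      (by linarith [div_pos hr0 hx0]) hκ1
    simpa using this
  have hpoly : g * r * (s * r - 1) ≤ (r - s) * (1 + κ * (r / x - 1)) := by
    have hid : (r - s) * (1 + κ * (r / x - 1)) - g * r * (s * r - 1)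
        = (κ / x - g * s) * (r - x) ^ 2 := by
      rw [hs, hκ]
      field_simp
      ring
    have hlead : 0 ≤ κ / x - g * s := by
      have : κ / x - g * s
          = (g + 1) * (g ^ 2 * x ^ 2 - 1) / (g * x * (x ^ 2 - 1) * (g * x ^ 2 + 1)) := by
        rw [hs, hκ]
        field_simp
        ring
      rw [this]
      have : 0 < g ^ 2 * x ^ 2 - 1 := by nlinarith [mul_pos (sub_pos.2 hg) hgx]
      positivity
    nlinarith [mul_nonneg hlead (sq_nonneg (r - x))]
  have hdiv : (r / x) ^ κ = r ^ κ / x ^ κ := Real.div_rpow hr0.le hx0.le κ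
  have hxκ : 0 < x ^ κ := Real.rpow_pos_of_pos hx0 κ
  have h1 : g * r * (s * r - 1) ≤ (r - s) * (r ^ κ / x ^ κ) := by
    rw [← hdiv]
    exact hpoly.trans (mul_le_mul_of_nonneg_left hbern (by linarith))
  have h2 := mul_le_mul_of_nonneg_right h1 (show 0 ≤ x ^ κ / (s * r) by positivity)
  have e1 : g * r * (s * r - 1) * (x ^ κ / (s * r)) = g * x ^ κ * (r - 1 / s) := by
    field_simp
  have e2 : (r - s) * (r ^ κ / x ^ κ) * (x ^ κ / (s * r)) = (1 / s - 1 / r) * r ^ κ := by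
    field_simp
  rwa [e1, e2] at h2

theorem tangent_ennreal {s κ b : ℝ} (hs : 0 < s) (hκ1 : 1 ≤ κ) (hb : 0 < b)
    (htan : ∀ r, 1 / s < r → b * (r - 1 / s) ≤ (1 / s - 1 / r) * r ^ κ)
    {p q : ℝ≥0∞} (hp0 : p ≠ 0) (hp : p ≠ ⊤) (hq : q ≠ ⊤) :
    (q - ENNReal.ofReal (1 / s) * p) * p ^ (κ - 1)
      ≤ ENNReal.ofReal (1 / b) * ((ENNReal.ofReal (1 / s) * q - p) * q ^ (κ - 1)) := by
  obtain ⟨p', hp'0, rfl⟩ : ∃ p' : ℝ, 0 ≤ p' ∧ p = ENNReal.ofReal p' :=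
    ⟨p.toReal, ENNReal.toReal_nonneg, (ENNReal.ofReal_toReal hp).symm⟩
  obtain ⟨q', hq'0, rfl⟩ : ∃ q' : ℝ, 0 ≤ q' ∧ q = ENNReal.ofReal q' :=
    ⟨q.toReal, ENNReal.toReal_nonneg, (ENNReal.ofReal_toReal hq).symm⟩
  have hp'' : 0 < p' := by simpa using hp0
  have hκ0 : 0 ≤ κ - 1 := by linarith
  rw [ENNReal.ofReal_rpow_of_nonneg hp'0 hκ0, ENNReal.ofReal_rpow_of_nonneg hq'0 hκ0,
    ← ENNReal.ofReal_mul (by positivity), ← ENNReal.ofReal_mul (by positivity),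
    ← ENNReal.ofReal_sub _ (by positivity), ← ENNReal.ofReal_sub _ (by positivity),
    ← ENNReal.ofReal_mul' (by positivity), ← ENNReal.ofReal_mul' (by positivity),
    ← ENNReal.ofReal_mul (by positivity)]
  by_cases hpq : q' ≤ 1 / s * p'
  · rw [ENNReal.ofReal_of_nonpos (p := (q' - 1 / s * p') * p' ^ (κ - 1))]
    · exact zero_le
    · exact mul_nonpos_of_nonpos_of_nonneg (by linarith) (by positivity)
  · push Not at hpq
    refine ENNReal.ofReal_le_ofReal ?_
    have hq'' : 0 < q' := lt_of_le_of_lt (by positivity) hpq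
    have h := htan (q' / p') (by rwa [lt_div_iff₀ hp''])
    have h1 : p' ^ κ = p' ^ (κ - 1) * p' := by
      rw [← Real.rpow_add_one hp''.ne']
      ring_nf
    have h2 : q' ^ κ = q' ^ (κ - 1) * q' := by
      rw [← Real.rpow_add_one hq''.ne']
      ring_nf
    rw [Real.div_rpow hq'0 hp'0, h1, h2] at h
    have hpk : 0 < p' ^ (κ - 1) := by positivity
    have h3 := mul_le_mul_of_nonneg_right h (show 0 ≤ p' ^ (κ - 1) * p' / b by positivity)
    have e1 : b * (q' / p' - 1 / s) * (p' ^ (κ - 1) * p' / b)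
        = (q' - 1 / s * p') * p' ^ (κ - 1) := by
      field_simp
    have e2 : (1 / s - 1 / (q' / p')) * (q' ^ (κ - 1) * q' / (p' ^ (κ - 1) * p'))
        * (p' ^ (κ - 1) * p' / b) = 1 / b * ((1 / s * q' - p') * q' ^ (κ - 1)) := by
      field_simp
    rwa [e1, e2] at h3

theorem hitGen_rpow_le {V : Type*} (G : WeightedGraph V) {o : V} {z : Set V} {n : ℕ}
    (hoz : o ∉ z) (hd : G.distGE o z n) {s κ b K : ℝ} (hs : 0 < s) (hs1 : s < 1) (hκ1 : 1 ≤ κ)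
    (hb : 1 ≤ b) (htan : ∀ r, 1 / s < r → b * (r - 1 / s) ≤ (1 / s - 1 / r) * r ^ κ)
    (hK : 0 ≤ K) (hw : G.setWeight z / G.vw o ≤ ENNReal.ofReal K) :
    (hitGen G z s o).toReal ^ κ * (1 - s) ≤ b * (K / b ^ n) := by
  have hb0 : 0 < b := by linarith
  set F := hitGen G z s with hF
  set σ := ENNReal.ofReal (1 / s) with hσ
  have hσ1 : 1 ≤ σ := by
    rw [hσ, ENNReal.one_le_ofReal, le_div_iff₀ hs]
    linarith
  have hF1 : ∀ x, F x ≤ 1 := hitGen_le_one G z hs.le hs1.le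
  have hFt : ∀ x, F x ≠ ⊤ := fun x => ne_top_of_le_ne_top ENNReal.one_ne_top (hF1 x)
  have hFz : ∀ x ∈ z, F x = 1 := fun x hx => hitGen_of_mem G s hx
  have hκ0 : 0 ≤ κ - 1 := by linarith
  have hpow : ∀ x, F x ^ (κ - 1) ≤ 1 := fun x => ENNReal.rpow_le_one (hF1 x) hκ0
  have hflow := weight_le_of_flow G hd {x | F o < F x} (fun x => F x ^ (κ - 1))
    (fun y => F y - F o) (fun x y => F y - σ * F x) (fun x y => σ * F y - F x)
    (ENNReal.ofReal (1 / b)) σ (fun x => ⌊Real.log (F x).toReal / Real.log s⌋₊)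
    (by
      rw [ENNReal.ofReal_le_one, div_le_one hb0]
      exact hb)
    (lt_irrefl (F o))
    (fun y hy => by
      by_contra h
      exact hy (tsub_eq_zero_of_le (not_lt.1 h)))
    (fun x hx y hy => by
      have h1 : σ * F x < F y := by
        by_contra h
        exact hy (tsub_eq_zero_of_le (not_lt.1 h))
      exact lt_of_lt_of_le (show F o < F x from hx)
        ((le_mul_of_one_le_left' hσ1).trans h1.le))
    (fun x hx y hy => by
      have h1 : σ * F x < F y := by
        by_contra h
        exact hy (tsub_eq_zero_of_le (not_lt.1 h))
      have hxpos : 0 < (F x).toReal :=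
        ENNReal.toReal_pos (pos_of_gt (show F o < F x from hx)).ne' (hFt x)
      have h2 : 1 / s * (F x).toReal < (F y).toReal := by
        have := ENNReal.toReal_strict_mono (hFt y) h1
        rwa [ENNReal.toReal_mul, hσ, ENNReal.toReal_ofReal (by positivity)] at this
      have hypos : 0 < (F y).toReal := lt_trans (by positivity) h2
      have hy1 : (F y).toReal ≤ 1 := ENNReal.toReal_mono ENNReal.one_ne_top (hF1 y)
      have hlogs : Real.log s < 0 := Real.log_neg hs hs1
      have h3 : -Real.log s + Real.log (F x).toReal < Real.log (F y).toReal := by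
        rw [← Real.log_inv, ← Real.log_mul (by positivity) hxpos.ne', ← one_div]
        exact Real.log_lt_log (by positivity) h2
      have h4 : 0 ≤ Real.log (F y).toReal / Real.log s :=
        div_nonneg_of_nonpos (Real.log_nonpos hypos.le hy1) hlogs.le
      rw [← Nat.add_one_le_iff, ← Nat.floor_add_one h4]
      refine Nat.floor_le_floor ?_
      rw [div_add_one hlogs.ne]
      exact div_le_div_of_nonpos_of_le hlogs.le (by linarith))
    (fun x hx _ y _ _ => tangent_ennreal hs hκ1 hb0 htan
        (pos_of_gt (show F o < F x from hx)).ne' (hFt x) (hFt y))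
    (fun x hx _ y hy _ => by
      refine (tangent_ennreal hs hκ1 hb0 htan
        (pos_of_gt (show F o < F x from hx)).ne' (hFt x) (hFt y)).trans ?_
      refine mul_le_mul_right ?_ _
      rw [hFz y hy, ENNReal.one_rpow, mul_one, mul_one]
      exact tsub_le_self)
    (fun y _ => by
      by_cases hy : F y ≤ F o
      · simp [tsub_eq_zero_of_le hy]
      · refine mul_le_mul' (tsub_le_tsub_right (le_mul_of_one_le_left' hσ1) _) ?_
        exact ENNReal.rpow_le_rpow (not_le.1 hy).le hκ0)
    (fun y hy => by
      rw [hFz y hy]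
      exact (mul_le_of_le_one_right' (hpow o)).trans (tsub_le_self.trans hσ1))
    (fun x _ hxz => by
      refine (tsum_mul_tsub_eq (G.w x) F (fun _ => σ * F x) (tsum_mul_hitGen G hs hxz) ?_).ge
      rw [tsum_mul_hitGen G hs hxz, ENNReal.tsum_mul_right]
      exact ENNReal.mul_ne_top (G.vw_lt_top x).ne
        (ENNReal.mul_ne_top ENNReal.ofReal_ne_top (hFt x)))
  have hv0 : G.vw o ≠ 0 := (G.vw_pos o).ne'
  have hvt : G.vw o ≠ ⊤ := (G.vw_lt_top o).ne
  have hsrc : G.vw o * (F o * (σ - 1)) ≤ ∑' y, G.w o y * (F y - F o) := by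
    have h1 := mul_tsum_le_mul_tsub (G.w o) F (fun _ => F o)
    rw [tsum_mul_hitGen G hs hoz, ENNReal.tsum_mul_right, ENNReal.tsum_mul_right] at h1
    change G.vw o * (σ * F o) ≤ _ + G.vw o * F o at h1
    have h2 := tsub_le_iff_right.2 h1
    refine le_trans (le_of_eq ?_) h2
    rw [ENNReal.mul_sub (fun _ _ => hFt o), ENNReal.mul_sub (fun _ _ => hvt), mul_one,
      mul_comm (F o) σ]
  have hsw : G.setWeight z ≤ ENNReal.ofReal K * G.vw o :=
    (ENNReal.div_le_iff hv0 hvt).1 hw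
  have hfin : G.vw o * (F o * (σ - 1) * F o ^ (κ - 1) * ENNReal.ofReal (1 / b))
      ≤ G.vw o * (σ * ENNReal.ofReal (1 / b) ^ n * ENNReal.ofReal K) := by
    calc G.vw o * (F o * (σ - 1) * F o ^ (κ - 1) * ENNReal.ofReal (1 / b))
        = G.vw o * (F o * (σ - 1)) * F o ^ (κ - 1) * ENNReal.ofReal (1 / b) := by ring
      _ ≤ (∑' y, G.w o y * (F y - F o)) * F o ^ (κ - 1) * ENNReal.ofReal (1 / b) := by gcongr
      _ ≤ σ * ENNReal.ofReal (1 / b) ^ n * G.setWeight z := hflow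
      _ ≤ σ * ENNReal.ofReal (1 / b) ^ n * (ENNReal.ofReal K * G.vw o) := by gcongr
      _ = _ := by ring
  have hfin := (ENNReal.mul_le_mul_iff_right hv0 hvt).1 hfin
  have hreal := ENNReal.toReal_mono (by finiteness) hfin
  have hβr : (ENNReal.ofReal (1 / b)).toReal = 1 / b := ENNReal.toReal_ofReal (by positivity)
  have hσr : σ.toReal = 1 / s := ENNReal.toReal_ofReal (by positivity)
  rw [ENNReal.toReal_mul, ENNReal.toReal_mul, ENNReal.toReal_mul, ENNReal.toReal_mul,
    ENNReal.toReal_mul, ENNReal.toReal_sub_of_le hσ1 (by finiteness), ENNReal.toReal_pow,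
    hβr, ENNReal.toReal_ofReal hK, hσr,
    ← ENNReal.toReal_rpow, ENNReal.toReal_one] at hreal
  set f := (F o).toReal with hf
  have hfk : f * f ^ (κ - 1) = f ^ κ := by
    by_cases hf0 : f = 0
    · rw [hf0, zero_mul, Real.zero_rpow (lt_of_lt_of_le one_pos hκ1).ne']
    · rw [mul_comm, ← Real.rpow_add_one hf0]
      ring_nf
  have h5 := mul_le_mul_of_nonneg_right hreal (show 0 ≤ s * b by positivity)
  have e1 : f * (1 / s - 1) * f ^ (κ - 1) * (1 / b) * (s * b) = f ^ κ * (1 - s) := by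
    rw [← hfk]
    field_simp
  have e2 : 1 / s * (1 / b) ^ n * K * (s * b) = b * (K / b ^ n) := by
    rw [one_div_pow]
    field_simp
  rwa [e1, e2] at h5


/-- The expected hitting time of `z`, as a function of the starting vertex. -/
noncomputable def meanHit {V : Type*} (G : WeightedGraph V) (z : Set V) (x : V) : ℝ≥0∞ :=
  ∑' k, survival G z k x

theorem meanHit_of_mem {V : Type*} (G : WeightedGraph V) {z : Set V} {x : V} (hx : x ∈ z) :
    meanHit G z x = 0 := by
  refine ENNReal.tsum_eq_zero.2 fun k => ?_
  cases k <;> simp [survival, hx]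

theorem meanHit_eq {V : Type*} (G : WeightedGraph V) {z : Set V} {x : V} (hx : x ∉ z) :
    meanHit G z x = 1 + ∑' y, G.trans x y * meanHit G z y := by
  rw [meanHit, tsum_eq_zero_add' ENNReal.summable]
  simp only [survival, hx, if_false, meanHit, ← ENNReal.tsum_mul_left]
  rw [ENNReal.tsum_comm]

theorem vw_mul_meanHit {V : Type*} (G : WeightedGraph V) {z : Set V} {x : V} (hx : x ∉ z) :
    G.vw x * meanHit G z x = G.vw x + ∑' y, G.w x y * meanHit G z y := by
  rw [meanHit_eq G hx, mul_add, mul_one, ← ENNReal.tsum_mul_left]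
  simp only [← mul_assoc, vw_mul_trans]

/-- The tangent line inequality for the expected one-step cost of the walk. -/
theorem tangent_exp {g κ : ℝ} (hg : 1 < g) (hκ : κ = (g - 1) ^ 2 / (2 * g)) {r : ℝ}
    (hr : -1 ≤ r) :
    g * Real.exp (κ * ((g + 1) / (g - 1))) * (r - 1) ≤ (r + 1) * Real.exp (κ * r) := by
  have hg1 : 0 < g - 1 := by linarith
  have h1 : g * (r - 1) ≤ (r + 1) * (κ * (r - (g + 1) / (g - 1)) + 1) := by
    have hid : (r + 1) * (κ * (r - (g + 1) / (g - 1)) + 1) - g * (r - 1)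
        = κ * (r - (g + 1) / (g - 1)) ^ 2 := by
      rw [hκ]
      field_simp
      ring
    have hκ0 : 0 ≤ κ := by rw [hκ]; positivity
    nlinarith [mul_nonneg hκ0 (sq_nonneg (r - (g + 1) / (g - 1)))]
  have h2 : g * (r - 1) ≤ (r + 1) * Real.exp (κ * (r - (g + 1) / (g - 1))) :=
    h1.trans (mul_le_mul_of_nonneg_left (Real.add_one_le_exp _) (by linarith))
  have h3 := mul_le_mul_of_nonneg_right h2 (Real.exp_pos (κ * ((g + 1) / (g - 1)))).le
  rw [mul_assoc (r + 1), ← Real.exp_add,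
    show κ * (r - (g + 1) / (g - 1)) + κ * ((g + 1) / (g - 1)) = κ * r by ring] at h3
  linarith

theorem mul_exp_neg_le {κ r : ℝ} (hκ : 0 < κ) : r * Real.exp (-(κ * r)) ≤ 1 / κ := by
  rw [Real.exp_neg, ← div_eq_mul_inv, div_le_div_iff₀ (Real.exp_pos _) hκ]
  linarith [Real.add_one_le_exp (κ * r)]

theorem exp_meanHit_le {V : Type*} (G : WeightedGraph V) {o : V} {z : Set V} {n : ℕ}
    (hoz : o ∉ z) (hd : G.distGE o z n) {κ b K : ℝ} (hκ : 0 < κ)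
    (hb : 1 ≤ b) (htan : ∀ r, -1 ≤ r → b * (r - 1) ≤ (r + 1) * Real.exp (κ * r))
    (hK : 0 ≤ K) (hw : G.setWeight z / G.vw o ≤ ENNReal.ofReal K)
    (hfin : meanHit G z o ≠ ⊤) :
    Real.exp (-(κ * (meanHit G z o).toReal)) ≤ b ^ 2 / κ * (K / b ^ n) := by
  have hb0 : 0 < b := by linarith
  set t := meanHit G z with ht
  have htz : ∀ x ∈ z, t x = 0 := fun x hx => meanHit_of_mem G hx
  set θ : V → ℝ≥0∞ := fun x => ENNReal.ofReal (Real.exp (-(κ * (t x).toReal))) with hθ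
  set c : ℝ≥0∞ := ENNReal.ofReal (b / κ) with hc
  have hRt : ∀ x, t x < t o → t x ≠ ⊤ := fun x hx => ne_top_of_lt hx
  have hlt : ∀ {x y}, t x - (t y + 1) ≠ 0 → t y + 1 < t x := fun h => by
    by_contra h'
    exact h (tsub_eq_zero_of_le (not_lt.1 h'))
  have hmul : ∀ (p q : ℝ), 0 ≤ q →
      ENNReal.ofReal p * ENNReal.ofReal q = ENNReal.ofReal (p * q) :=
    fun p q hq => (ENNReal.ofReal_mul' hq).symm
  have hflow := weight_le_of_flow G hd {x | t x < t o} θ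
    (fun y => t o - t y) (fun x y => t x - (t y + 1)) (fun x y => t x + 1 - t y)
    (ENNReal.ofReal (1 / b)) c (fun x => ⌊(t x).toReal⌋₊)
    (by
      rw [ENNReal.ofReal_le_one, div_le_one hb0]
      exact hb)
    (lt_irrefl (t o))
    (fun y hy => by
      by_contra h
      exact hy (tsub_eq_zero_of_le (not_lt.1 h)))
    (fun x hx y hy => lt_of_le_of_lt (le_self_add.trans (hlt hy).le) hx)
    (fun x hx y hy => by
      have h1 := hlt hy
      have hyt : t y ≠ ⊤ := ne_top_of_le_ne_top (hRt x hx) (le_self_add.trans h1.le)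
      have h2 := ENNReal.toReal_mono (hRt x hx) h1.le
      rw [ENNReal.toReal_add hyt ENNReal.one_ne_top, ENNReal.toReal_one] at h2
      change ⌊(t y).toReal⌋₊ < ⌊(t x).toReal⌋₊
      rw [← Nat.add_one_le_iff, ← Nat.floor_add_one ENNReal.toReal_nonneg]
      exact Nat.floor_le_floor h2)
    (fun x hx _ y _ _ => by
      by_cases hxy : t x - (t y + 1) = 0
      · simp [hxy]
      have h1 := hlt hxy
      have hxt := hRt x hx
      have hyt : t y ≠ ⊤ := ne_top_of_le_ne_top hxt (le_self_add.trans h1.le)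
      have ex : t x = ENNReal.ofReal (t x).toReal := (ENNReal.ofReal_toReal hxt).symm
      have ey : t y = ENNReal.ofReal (t y).toReal := (ENNReal.ofReal_toReal hyt).symm
      have h2 := ENNReal.toReal_mono hxt h1.le
      rw [ENNReal.toReal_add hyt ENNReal.one_ne_top, ENNReal.toReal_one] at h2
      have eu : t x - (t y + 1) = ENNReal.ofReal ((t x).toReal - ((t y).toReal + 1)) := by
        rw [ENNReal.ofReal_sub _ (by positivity), ENNReal.ofReal_add (by positivity) zero_le_one,
          ← ex, ← ey, ENNReal.ofReal_one]
      have eδ : t x + 1 - t y = ENNReal.ofReal ((t x).toReal + 1 - (t y).toReal) := by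
        rw [ENNReal.ofReal_sub _ (by positivity), ENNReal.ofReal_add (by positivity) zero_le_one,
          ← ex, ← ey, ENNReal.ofReal_one]
      rw [eu, eδ, hθ, hmul _ _ (by positivity), hmul _ _ (by positivity),
        ← ENNReal.ofReal_mul (by positivity)]
      refine ENNReal.ofReal_le_ofReal ?_
      set p := (t x).toReal
      set q := (t y).toReal
      have h3 := mul_le_mul_of_nonneg_right (htan (p - q) (by linarith))
        (show 0 ≤ 1 / b * Real.exp (-(κ * p)) by positivity)
      have e1 : Real.exp (κ * (p - q)) * Real.exp (-(κ * p)) = Real.exp (-(κ * q)) := by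
        rw [← Real.exp_add]
        ring_nf
      calc (p - (q + 1)) * Real.exp (-(κ * p))
          = b * (p - q - 1) * (1 / b * Real.exp (-(κ * p))) := by
            field_simp
            ring
        _ ≤ (p - q + 1) * Real.exp (κ * (p - q)) * (1 / b * Real.exp (-(κ * p))) := h3
        _ = 1 / b * ((p - q + 1) * (Real.exp (κ * (p - q)) * Real.exp (-(κ * p)))) := by ring
        _ = 1 / b * ((p + 1 - q) * Real.exp (-(κ * q))) := by
            rw [e1]
            ring)
    (fun x hx _ y hy _ => by
      have hxt := hRt x hx
      calc (t x - (t y + 1)) * θ x ≤ t x * θ x := by gcongr; exact tsub_le_self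
        _ = ENNReal.ofReal ((t x).toReal * Real.exp (-(κ * (t x).toReal))) := by
            rw [← hmul _ _ (by positivity), ENNReal.ofReal_toReal hxt]
        _ ≤ ENNReal.ofReal (1 / κ) := ENNReal.ofReal_le_ofReal (mul_exp_neg_le hκ)
        _ = ENNReal.ofReal (1 / b) * c := by
            rw [hc, ← ENNReal.ofReal_mul (by positivity)]
            congr 1
            field_simp)
    (fun y _ => by
      by_cases hy : t y < t o
      · refine mul_le_mul' (tsub_le_tsub_right le_self_add _) ?_
        refine ENNReal.ofReal_le_ofReal (Real.exp_le_exp.2 ?_)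
        have := ENNReal.toReal_mono hfin hy.le
        nlinarith
      · simp [tsub_eq_zero_of_le (not_lt.1 hy)])
    (fun y hy => by
      rw [htz y hy, tsub_zero]
      calc t o * θ o = ENNReal.ofReal ((t o).toReal * Real.exp (-(κ * (t o).toReal))) := by
            rw [← hmul _ _ (by positivity), ENNReal.ofReal_toReal hfin]
        _ ≤ c := by
            refine ENNReal.ofReal_le_ofReal ((mul_exp_neg_le hκ).trans ?_)
            gcongr)
    (fun x hx hxz => by
      have h1 : ∑' y, G.w x y * t x = ∑' y, G.w x y * (t y + 1) := by
        simp only [mul_add, mul_one, ENNReal.tsum_add, ENNReal.tsum_mul_right]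
        rw [add_comm (∑' y, G.w x y * t y)]
        exact vw_mul_meanHit G hxz
      refine (tsum_mul_tsub_eq (G.w x) (fun _ => t x) (fun y => t y + 1) h1 ?_).ge
      rw [ENNReal.tsum_mul_right]
      exact ENNReal.mul_ne_top (G.vw_lt_top x).ne (hRt x hx))
  have hv0 : G.vw o ≠ 0 := (G.vw_pos o).ne'
  have hvt : G.vw o ≠ ⊤ := (G.vw_lt_top o).ne
  have hsrc : G.vw o ≤ ∑' y, G.w o y * (t o - t y) := by
    have h1 := mul_tsum_le_mul_tsub (G.w o) (fun _ => t o) t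
    rw [ENNReal.tsum_mul_right] at h1
    change G.vw o * t o ≤ _ at h1
    have h2 := vw_mul_meanHit G hoz
    have h3 : ∑' y, G.w o y * t y ≠ ⊤ :=
      ne_top_of_le_ne_top (ENNReal.mul_ne_top hvt hfin) (h2 ▸ le_add_self)
    change G.vw o * t o = _ at h2
    rw [h2] at h1
    exact (ENNReal.add_le_add_iff_right h3).1 h1
  have hsw : G.setWeight z ≤ ENNReal.ofReal K * G.vw o :=
    (ENNReal.div_le_iff hv0 hvt).1 hw
  have hmain : G.vw o * (θ o * ENNReal.ofReal (1 / b))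
      ≤ G.vw o * (c * ENNReal.ofReal (1 / b) ^ n * ENNReal.ofReal K) := by
    calc G.vw o * (θ o * ENNReal.ofReal (1 / b)) = G.vw o * θ o * ENNReal.ofReal (1 / b) := by ring
      _ ≤ (∑' y, G.w o y * (t o - t y)) * θ o * ENNReal.ofReal (1 / b) := by gcongr
      _ ≤ c * ENNReal.ofReal (1 / b) ^ n * G.setWeight z := hflow
      _ ≤ c * ENNReal.ofReal (1 / b) ^ n * (ENNReal.ofReal K * G.vw o) := by gcongr
      _ = _ := by ring
  have hmain := (ENNReal.mul_le_mul_iff_right hv0 hvt).1 hmain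
  rw [hθ, hc, ← ENNReal.ofReal_pow (by positivity), ← ENNReal.ofReal_mul (by positivity),
    ← ENNReal.ofReal_mul (by positivity), ← ENNReal.ofReal_mul (by positivity),
    ENNReal.ofReal_le_ofReal_iff (by positivity)] at hmain
  have h5 := mul_le_mul_of_nonneg_right hmain hb0.le
  have e1 : Real.exp (-(κ * (t o).toReal)) * (1 / b) * b = Real.exp (-(κ * (t o).toReal)) := by
    field_simp
  have e2 : b / κ * (1 / b) ^ n * K * b = b ^ 2 / κ * (K / b ^ n) := by
    rw [one_div_pow]
    field_simp
  rwa [e1, e2] at h5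


lemma exp_neg_IgBar {g a x s : ℝ} (hg : 1 < g) (ha : 1 < a) (hne : a ≠ (g + 1) / (g - 1))
    (hx : 0 < x) (hxa : g * (a - 1) * x ^ 2 = a + 1) (hs : s = (g + 1) * x * (a - 1) / (2 * a)) :
    Real.exp (-(IgBar g a)) = s ^ (-a) * x⁻¹ := by
  have hg0 : 0 < g := by linarith
  have ha0 : 0 < a := by linarith
  have ha1 : 0 < a - 1 := by linarith
  have ha2 : 0 < a + 1 := by linarith
  have hg1 : 0 < g + 1 := by linarith
  have hsq : a ^ 2 - 1 = (a - 1) * (a + 1) := by ring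
  have hs0 : 0 < s := by rw [hs]; positivity
  have hlogx : Real.log g + Real.log (a - 1) + 2 * Real.log x = Real.log (a + 1) := by
    rw [← hxa, Real.log_mul (by positivity) (by positivity), Real.log_mul hg0.ne' ha1.ne',
      Real.log_pow]
    norm_num
  have hlogs : Real.log s
      = Real.log (g + 1) + Real.log x + Real.log (a - 1) - Real.log (2 * a) := by
    rw [hs, Real.log_div (by positivity) (by positivity), Real.log_mul (by positivity) ha1.ne',
      Real.log_mul hg1.ne' hx.ne']
  have hpos : 0 < g / (a + 1) * (g / (a ^ 2 - 1)) ^ ((a - 1) / 2) * (2 * a / (g + 1)) ^ a := by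
    rw [hsq]; positivity
  rw [IgBar, if_neg hne, neg_neg, Real.exp_log hpos]
  refine Real.log_injOn_pos hpos (by positivity : (0 : ℝ) < s ^ (-a) * x⁻¹) ?_
  have hq : 0 < g / (a ^ 2 - 1) := by rw [hsq]; positivity
  have hr : 0 < 2 * a / (g + 1) := by positivity
  rw [Real.log_mul (by positivity) (by positivity), Real.log_mul (by positivity) (by positivity),
    Real.log_mul (by positivity) (by positivity), Real.log_rpow hq, Real.log_rpow hr,
    Real.log_rpow hs0, Real.log_inv, Real.log_div hg0.ne' ha2.ne', hsq,
    Real.log_div hg0.ne' (by positivity), Real.log_div (by positivity) hg1.ne',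
    Real.log_mul ha1.ne' ha2.ne', hlogs, ← hlogx]
  ring

/-- The constant multiplying the exponential rate stays bounded as `x ↓ 1`. -/
lemma rpow_inv_le_of_le {g x x₀ s κ C M : ℝ} (hg : 1 < g) (hx : 1 < x) (hx₀ : x ≤ x₀)
    (hs : s = (g + 1) * x / (g * x ^ 2 + 1))
    (hκ : κ = (g + 1) * (g * x ^ 2 - 1) / (g * (x ^ 2 - 1))) (hκ1 : 1 ≤ κ) (hC : 0 < C)
    (hM : M = (x₀ + 1) * (g * x₀ ^ 2 + 1) * g / ((g - 1) ^ 2 * (g + 1)) + 1) :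
    (g * x ^ κ * C / (1 - s)) ^ κ⁻¹ ≤ g * x₀ * (1 + C) * (M * Real.exp 1) := by
  have hκ0 : 0 < κ := by linarith
  have hg1 : 0 < g - 1 := by linarith
  have hx1 : 0 < x - 1 := by linarith
  have hx0 : 0 < x := by linarith
  have hgx : g - 1 ≤ g * x - 1 := by nlinarith
  have hx2 : 1 < x ^ 2 := by nlinarith
  have hx22 : 0 < x ^ 2 - 1 := by linarith
  have hgx2 : g - 1 ≤ g * x ^ 2 - 1 := by nlinarith
  have hM1 : 1 ≤ M := by
    rw [hM]
    have : 0 ≤ (x₀ + 1) * (g * x₀ ^ 2 + 1) * g / ((g - 1) ^ 2 * (g + 1)) := by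
      have : 0 < x₀ := by linarith
      positivity
    linarith
  have h1s : 1 - s = (g * x - 1) * (x - 1) / (g * x ^ 2 + 1) := by
    rw [hs]; field_simp; ring
  have h1s0 : 0 < 1 - s := by
    rw [h1s]
    have : 0 < g * x - 1 := by linarith
    positivity
  have hδ0 : 0 < κ⁻¹ := by positivity
  have hδ1 : κ⁻¹ ≤ 1 := inv_le_one_of_one_le₀ hκ1
  have key : 1 / (1 - s) ≤ M * κ := by
    have e : 1 / (1 - s)
        = (x + 1) * (g * x ^ 2 + 1) * g / ((g * x - 1) * (g * x ^ 2 - 1) * (g + 1)) * κ := by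
      have h1 : g * x - 1 ≠ 0 := by linarith
      have h2 : g * x ^ 2 - 1 ≠ 0 := by linarith
      have h3 : x ^ 2 - 1 ≠ 0 := hx22.ne'
      have h4 : x - 1 ≠ 0 := hx1.ne'
      rw [h1s, hκ, one_div_div]
      field_simp
      ring
    rw [e]
    gcongr
    rw [hM]
    have : (x + 1) * (g * x ^ 2 + 1) * g / ((g * x - 1) * (g * x ^ 2 - 1) * (g + 1))
        ≤ (x₀ + 1) * (g * x₀ ^ 2 + 1) * g / ((g - 1) ^ 2 * (g + 1)) := by
      rw [sq (g - 1)]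
      have : 0 < x₀ := by linarith
      have : 0 ≤ g * x - 1 := by linarith
      gcongr
    linarith
  have hb : (g * x ^ κ) ^ κ⁻¹ ≤ g * x₀ := by
    rw [Real.mul_rpow (by linarith) (by positivity), Real.rpow_rpow_inv hx0.le hκ0.ne']
    have : g ^ κ⁻¹ ≤ g ^ (1 : ℝ) := Real.rpow_le_rpow_of_exponent_le hg.le hδ1
    rw [Real.rpow_one] at this
    gcongr
  have hCδ : C ^ κ⁻¹ ≤ 1 + C := by
    have h1 : C ^ κ⁻¹ ≤ (1 + C) ^ κ⁻¹ := Real.rpow_le_rpow hC.le (by linarith) hδ0.le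
    have h2 : (1 + C) ^ κ⁻¹ ≤ (1 + C) ^ (1 : ℝ) :=
      Real.rpow_le_rpow_of_exponent_le (by linarith) hδ1
    rw [Real.rpow_one] at h2
    exact h1.trans h2
  have hMδ : M ^ κ⁻¹ ≤ M := by
    have h2 : M ^ κ⁻¹ ≤ M ^ (1 : ℝ) := Real.rpow_le_rpow_of_exponent_le hM1 hδ1
    rwa [Real.rpow_one] at h2
  have hκδ : κ ^ κ⁻¹ ≤ Real.exp 1 := by
    rw [Real.rpow_def_of_pos hκ0, Real.exp_le_exp]
    have : Real.log κ ≤ κ := by linarith [Real.log_le_sub_one_of_pos hκ0]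
    calc Real.log κ * κ⁻¹ ≤ κ * κ⁻¹ := by gcongr
      _ = 1 := mul_inv_cancel₀ hκ0.ne'
  have hlast : (1 / (1 - s)) ^ κ⁻¹ ≤ M * Real.exp 1 := by
    calc (1 / (1 - s)) ^ κ⁻¹ ≤ (M * κ) ^ κ⁻¹ :=
          Real.rpow_le_rpow (by positivity) key hδ0.le
      _ = M ^ κ⁻¹ * κ ^ κ⁻¹ := Real.mul_rpow (by linarith) hκ0.le
      _ ≤ M * Real.exp 1 := by gcongr
  rw [show g * x ^ κ * C / (1 - s) = (g * x ^ κ) * C * (1 / (1 - s)) by ring,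
    Real.mul_rpow (by positivity) (by positivity), Real.mul_rpow (by positivity) hC.le]
  have : 0 < x₀ := by linarith
  gcongr

/-- Markov's inequality for `s ^ T` with `s ≤ 1`, in terms of generating functions. -/
lemma sum_firstHit_le {V : Type*} (G : WeightedGraph V) (z : Set V) (o : V) {s t : ℝ}
    (hs : 0 < s) (hs1 : s ≤ 1) (ht : 0 ≤ t) :
    ∑ j ∈ Finset.range (⌊t⌋₊ + 1), firstHit G z j o
      ≤ ENNReal.ofReal (s ^ (-t)) * hitGen G z s o := by
  rw [hitGen, ← ENNReal.tsum_mul_left]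
  refine le_trans (Finset.sum_le_sum fun j hj => ?_) (ENNReal.sum_le_tsum (Finset.range (⌊t⌋₊ + 1)))
  have hj : (j : ℝ) ≤ t :=
    (Nat.le_floor_iff ht).1 (Nat.lt_succ_iff.1 (Finset.mem_range.1 hj))
  rw [← mul_assoc, ← ENNReal.ofReal_mul (by positivity)]
  refine le_mul_of_one_le_left' ?_
  rw [ENNReal.one_le_ofReal, ← Real.rpow_natCast, ← Real.rpow_add hs]
  exact Real.one_le_rpow_of_pos_of_le_one_of_nonpos hs hs1 (by linarith)

lemma notMem_of_distGE {V : Type*} {G : WeightedGraph V} {o : V} {z : Set V} {n : ℕ}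
    (hn : 1 ≤ n) (hd : G.distGE o z n) : o ∉ z := fun h => by
  have := hd 0 (fun _ => o) rfl (fun i hi => absurd hi (Nat.not_lt_zero i)) h
  omega

lemma lt_meanHit {V : Type*} (G : WeightedGraph V) {o : V} {z : Set V} {n : ℕ} {C g : ℝ}
    (hC : 0 < C) (hg : 1 < g) (hn : 1 ≤ n) (hd : G.distGE o z n)
    (hw : G.setWeight z / G.vw o ≤ ENNReal.ofReal (C * g ^ n)) {κ b C₂ : ℝ}
    (hκ : κ = (g - 1) ^ 2 / (2 * g)) (hb : b = g * Real.exp (κ * ((g + 1) / (g - 1))))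
    (hC₂ : Real.log (b ^ 2 / κ * C) / κ < C₂) :
    ENNReal.ofReal ((n : ℝ) * (g + 1) / (g - 1) - C₂) < meanHit G z o := by
  have hoz := notMem_of_distGE hn hd
  by_cases hfin : meanHit G z o = ⊤
  · rw [hfin]; exact ENNReal.ofReal_lt_top
  have hg1 : 0 < g - 1 := by linarith
  have hκ0 : 0 < κ := by rw [hκ]; positivity
  have hb1 : 1 ≤ b := by
    rw [hb]
    have h : 1 ≤ Real.exp (κ * ((g + 1) / (g - 1))) := Real.one_le_exp (by positivity)
    nlinarith
  have hb0 : 0 < b := by linarith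
  have h := exp_meanHit_le G hoz hd hκ0 hb1
    (fun r hr => by rw [hb]; exact tangent_exp hg hκ hr) (by positivity : 0 ≤ C * g ^ n) hw hfin
  have hpos : 0 < (meanHit G z o).toReal := by
    refine ENNReal.toReal_pos ?_ hfin
    rw [meanHit_eq G hoz]
    exact (lt_of_lt_of_le one_pos le_self_add).ne'
  rw [← ENNReal.ofReal_toReal hfin, ENNReal.ofReal_lt_ofReal_iff hpos]
  have h2 : Real.exp (-(κ * (meanHit G z o).toReal))
      ≤ b ^ 2 / κ * C * Real.exp (-(κ * ((g + 1) / (g - 1)) * n)) := by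
    refine h.trans_eq ?_
    rw [show -(κ * ((g + 1) / (g - 1)) * n) = -(n * (κ * ((g + 1) / (g - 1)))) by ring,
      Real.exp_neg, Real.exp_nat_mul, ← div_eq_mul_inv]
    have : b ^ n = g ^ n * Real.exp (κ * ((g + 1) / (g - 1))) ^ n := by rw [hb, mul_pow]
    rw [this]
    have : g ^ n ≠ 0 := by positivity
    field_simp
  have hE : 0 < b ^ 2 / κ * C := by positivity
  rw [← Real.exp_log hE, ← Real.exp_add, Real.exp_le_exp] at h2
  rw [div_lt_iff₀ hκ0] at hC₂
  have : κ * ((n : ℝ) * (g + 1) / (g - 1) - C₂) < κ * (meanHit G z o).toReal := by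
    have : κ * ((n : ℝ) * (g + 1) / (g - 1)) = κ * ((g + 1) / (g - 1)) * n := by ring
    nlinarith
  exact lt_of_mul_lt_mul_left this hκ0.le

lemma hitGen_le_mul_pow {V : Type*} (G : WeightedGraph V) {o : V} {z : Set V} {n : ℕ}
    {C g x x₀ s κ M : ℝ} (hC : 0 < C) (hg : 1 < g) (hn : 1 ≤ n) (hd : G.distGE o z n)
    (hw : G.setWeight z / G.vw o ≤ ENNReal.ofReal (C * g ^ n)) (hx : 1 < x) (hx₀ : x ≤ x₀)
    (hs : s = (g + 1) * x / (g * x ^ 2 + 1))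
    (hκ : κ = (g + 1) * (g * x ^ 2 - 1) / (g * (x ^ 2 - 1))) (hκ1 : 1 ≤ κ)
    (hs0 : 0 < s) (hs1 : s < 1)
    (hM : M = (x₀ + 1) * (g * x₀ ^ 2 + 1) * g / ((g - 1) ^ 2 * (g + 1)) + 1) :
    hitGen G z s o
      ≤ ENNReal.ofReal (g * x₀ * (1 + C) * (M * Real.exp 1) * x⁻¹ ^ n) := by
  have hoz := notMem_of_distGE hn hd
  have hκ0 : 0 < κ := by linarith
  have hx0 : 0 < x := by linarith
  have hxκ : 1 ≤ x ^ κ := Real.one_le_rpow hx.le hκ0.le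
  have hb1 : 1 ≤ g * x ^ κ := by nlinarith
  have h := hitGen_rpow_le G hoz hd hs0 hs1 hκ1 hb1
    (fun r hr => tangent_rpow hg hx hs hκ hκ1 hr) (by positivity : 0 ≤ C * g ^ n) hw
  have hfin : hitGen G z s o ≠ ⊤ :=
    ne_top_of_le_ne_top ENNReal.one_ne_top (hitGen_le_one G z hs0.le hs1.le o)
  rw [← ENNReal.ofReal_toReal hfin]
  refine ENNReal.ofReal_le_ofReal ?_
  set F := (hitGen G z s o).toReal with hF
  have hF0 : 0 ≤ F := ENNReal.toReal_nonneg
  have h1s : 0 < 1 - s := by linarith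
  have h2 : F ^ κ ≤ g * x ^ κ * C / (1 - s) * (x⁻¹ ^ n) ^ κ := by
    rw [div_mul_eq_mul_div, le_div_iff₀ h1s]
    refine h.trans_eq ?_
    have e : (x⁻¹ ^ n) ^ κ = ((x ^ κ) ^ n)⁻¹ := by
      rw [← Real.rpow_natCast, ← Real.rpow_mul (by positivity), mul_comm, Real.rpow_mul (by positivity),
        Real.inv_rpow hx0.le, Real.rpow_natCast, inv_pow]
    rw [e, mul_pow]
    have : g ^ n ≠ 0 := by positivity
    have : (x ^ κ) ^ n ≠ 0 := by positivity
    field_simp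
  have hA : 0 ≤ g * x ^ κ * C / (1 - s) := by positivity
  calc F = (F ^ κ) ^ κ⁻¹ := (Real.rpow_rpow_inv hF0 hκ0.ne').symm
    _ ≤ (g * x ^ κ * C / (1 - s) * (x⁻¹ ^ n) ^ κ) ^ κ⁻¹ :=
        Real.rpow_le_rpow (by positivity) h2 (by positivity)
    _ = (g * x ^ κ * C / (1 - s)) ^ κ⁻¹ * x⁻¹ ^ n := by
        rw [Real.mul_rpow hA (by positivity), Real.rpow_rpow_inv (by positivity) hκ0.ne']
    _ ≤ _ := by
        gcongr
        exact rpow_inv_le_of_le hg hx hx₀ hs hκ hκ1 hC hM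

lemma measure_hitTime_le_rate {V : Type*} [Countable V] [MeasurableSpace V]
    [MeasurableSingletonClass V] (G : WeightedGraph V) {o : V} {z : Set V} {μ : Measure (ℕ → V)}
    (hμ : IsRandomWalk G o μ) {n : ℕ}
    {C g a a₀ x₀ M : ℝ} (hC : 0 < C) (hg : 1 < g) (hn : 1 ≤ n) (hd : G.distGE o z n)
    (hw : G.setWeight z / G.vw o ≤ ENNReal.ofReal (C * g ^ n)) (ha₀ : 1 < a₀) (ha : a₀ ≤ a)
    (ha' : a < (g + 1) / (g - 1)) (hx₀ : x₀ = √((a₀ + 1) / (g * (a₀ - 1))))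
    (hM : M = (x₀ + 1) * (g * x₀ ^ 2 + 1) * g / ((g - 1) ^ 2 * (g + 1)) + 1) :
    μ {ω | hitTime z ω ≤ ENNReal.ofReal (a * n)}
      ≤ ENNReal.ofReal (g * x₀ * (1 + C) * (M * Real.exp 1) * Real.exp (-(IgBar g a) * n)) := by
  have hg1 : 0 < g - 1 := by linarith
  have hga : a * (g - 1) < g + 1 := (lt_div_iff₀ hg1).1 ha'
  have ha1 : 0 < a - 1 := by linarith
  have ha01 : 0 < a₀ - 1 := by linarith
  have ha0 : 0 < a := by linarith
  have hq : 0 < g * (a - 1) := by positivity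
  set x := √((a + 1) / (g * (a - 1))) with hxdef
  have hxsq : x ^ 2 = (a + 1) / (g * (a - 1)) := Real.sq_sqrt (by positivity)
  have hx : 1 < x := by
    rw [hxdef, Real.lt_sqrt one_pos.le, one_pow, one_lt_div hq]
    nlinarith
  have hx0 : 0 < x := by linarith
  have hxx₀ : x ≤ x₀ := by
    rw [hx₀]
    refine Real.sqrt_le_sqrt ?_
    rw [div_le_div_iff₀ hq (by positivity)]
    nlinarith [mul_nonneg (by linarith : 0 ≤ g) (by linarith : 0 ≤ a - a₀)]
  have hxa : g * (a - 1) * x ^ 2 = a + 1 := by rw [hxsq]; field_simp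
  set s := (g + 1) * x / (g * x ^ 2 + 1) with hs
  set κ := (g + 1) * (g * x ^ 2 - 1) / (g * (x ^ 2 - 1)) with hκ
  have hx2 : 0 < x ^ 2 - 1 := by nlinarith
  have hκ1 : 1 ≤ κ := by
    rw [hκ, one_le_div (by positivity)]
    nlinarith
  have hs0 : 0 < s := by positivity
  have hs1 : s < 1 := by
    have hgx : 0 < g * x - 1 := by nlinarith
    rw [hs, div_lt_one (by positivity)]
    nlinarith [mul_pos hgx (by linarith : 0 < x - 1)]
  have hsa : s = (g + 1) * x * (a - 1) / (2 * a) := by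
    rw [hs, div_eq_div_iff (by positivity) (by positivity)]
    linear_combination (-(g + 1) * x) * hxa
  have hIg : Real.exp (-(IgBar g a) * n) = s ^ (-(a * n)) * x⁻¹ ^ n := by
    rw [mul_comm, Real.exp_nat_mul, exp_neg_IgBar hg (by linarith) ha'.ne hx0 hxa hsa, mul_pow,
      ← Real.rpow_natCast (s ^ (-a)), ← Real.rpow_mul hs0.le, neg_mul]
  have hx₀0 : 0 < x₀ := by linarith
  calc μ {ω | hitTime z ω ≤ ENNReal.ofReal (a * n)}
      ≤ ∑ j ∈ Finset.range (⌊a * n⌋₊ + 1), firstHit G z j o :=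
        measure_hitTime_le G z hμ (by positivity)
    _ ≤ ENNReal.ofReal (s ^ (-(a * n))) * hitGen G z s o :=
        sum_firstHit_le G z o hs0 hs1.le (by positivity)
    _ ≤ ENNReal.ofReal (s ^ (-(a * n)))
          * ENNReal.ofReal (g * x₀ * (1 + C) * (M * Real.exp 1) * x⁻¹ ^ n) := by
        gcongr
        exact hitGen_le_mul_pow G hC hg hn hd hw hx hxx₀ hs hκ hκ1 hs0 hs1 hM
    _ = _ := by
        rw [← ENNReal.ofReal_mul (by positivity), hIg]
        congr 1
        ring

/-- Uniform bounds: for constants `C₁, C₂ > 0` depending only on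
`C, g, a₀`, every weighted graph with `dist(o,z) ≥ n` and `w_z/w_o ≤ C gⁿ` satisfies
`E T_{oz} > n(g+1)/(g-1) - C₂` and `P[T_{oz} ≤ an] < C₁ e^{-I_g(a) n}` for all
`a ∈ [a₀, (g+1)/(g-1)]`. -/
theorem uniform_large_deviation_bounds
    (C g a₀ : ℝ) (hC : 0 < C) (hg : 1 < g) (ha₀ : 1 < a₀) (ha₀' : a₀ < (g + 1) / (g - 1)) :
    ∃ C₁ C₂ : ℝ, 0 < C₁ ∧ 0 < C₂ ∧
      ∀ (V : Type) (_ : Countable V) (_ : MeasurableSpace V), MeasurableSingletonClass V →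
        ∀ (G : WeightedGraph V) (o : V) (z : Set V) (μ : Measure (ℕ → V)),
          IsRandomWalk G o μ →
          ∀ n : ℕ, 1 ≤ n → G.distGE o z n →
            G.setWeight z / G.vw o ≤ ENNReal.ofReal (C * g ^ n) →
            (ENNReal.ofReal ((n : ℝ) * (g + 1) / (g - 1) - C₂) < expHit μ z ∧
              ∀ a : ℝ, a ∈ Set.Icc a₀ ((g + 1) / (g - 1)) →
                μ {ω | hitTime z ω ≤ ENNReal.ofReal (a * n)}
                  < ENNReal.ofReal (C₁ * Real.exp (-(IgBar g a) * n))) := by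
  set κ : ℝ := (g - 1) ^ 2 / (2 * g) with hκ
  set b : ℝ := g * Real.exp (κ * ((g + 1) / (g - 1))) with hb
  set x₀ : ℝ := √((a₀ + 1) / (g * (a₀ - 1))) with hx₀
  set M : ℝ := (x₀ + 1) * (g * x₀ ^ 2 + 1) * g / ((g - 1) ^ 2 * (g + 1)) + 1 with hM
  set D : ℝ := g * x₀ * (1 + C) * (M * Real.exp 1) with hD
  have hg1 : 0 < g - 1 := by linarith
  have hM0 : 0 ≤ M := by positivity
  have hD0 : 0 ≤ D := by positivity
  refine ⟨D + 2, |Real.log (b ^ 2 / κ * C) / κ| + 1, by positivity, by positivity, ?_⟩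
  intro V _ _ _ G o z μ hμ n hn hd hw
  refine ⟨?_, fun a ha => ?_⟩
  · refine lt_of_lt_of_le ?_ (tsum_survival_le_expHit G z hμ)
    exact lt_meanHit G hC hg hn hd hw hκ hb (lt_of_le_of_lt (le_abs_self _) (lt_add_one _))
  · rcases ha.2.eq_or_lt with heq | hlt
    · have := hμ.1
      refine lt_of_le_of_lt prob_le_one ?_
      rw [IgBar, if_pos heq, neg_zero, zero_mul, Real.exp_zero, mul_one, ENNReal.one_lt_ofReal]
      linarith
    · refine lt_of_le_of_lt (measure_hitTime_le_rate G hμ hC hg hn hd hw ha₀ ha.1 hlt hx₀ hM) ?_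
      rw [ENNReal.ofReal_lt_ofReal_iff (by positivity)]
      have := Real.exp_pos (-(IgBar g a) * n)
      gcongr
      linarith

end RWHitting
end
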